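/- arXiv:1904.00556 — 4 statements merged into one kernel-verified Lean document; each statement's English description precedes it below -/
import Mathlib

section
/- The sequence x₁, x₄ is a regular sequence on R/𝔭; in particular, R/𝔭 is a two-dimensional Cohen–Macaulay ring. -/
open MvPolynomial

noncomputable def curveMap (k : Type*) [Field k] (q m : ℕ) :
    MvPolynomial (Fin 4) k →ₐ[k] MvPolynomial (Fin 2) k :=
  aeval ![X 0 ^ (2*q+1+2*m), X 0 ^ (2*q+1+m) * X 1 ^ m, X 0 ^ (2*q+1) * X 1 ^ (2*m),
    X 1 ^ (2*q+1+2*m)]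

noncomputable def curveIdeal (k : Type*) [Field k] (q m : ℕ) : Ideal (MvPolynomial (Fin 4) k) :=
  RingHom.ker (curveMap k q m)

instance (k : Type*) [Field k] (q m : ℕ) : (curveIdeal k q m).IsPrime :=
  RingHom.ker_isPrime _

noncomputable def symbPow (k : Type*) [Field k] (q m n : ℕ) :
    Ideal (MvPolynomial (Fin 4) k) :=
  (Ideal.map (algebraMap _ (Localization.AtPrime (curveIdeal k q m)))
      ((curveIdeal k q m) ^ n)).comap
    (algebraMap _ (Localization.AtPrime (curveIdeal k q m)))

noncomputable def fPoly (k : Type*) [Field k] (q m : ℕ) : MvPolynomial (Fin 4) k :=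
  - X 2 ^ (2*(q+m)+1) - X 0 ^ (q-1) * X 1 ^ 3 * X 2 ^ (q+m-1) * X 3 ^ m
    + 3 * X 0 ^ q * X 1 * X 2 ^ (q+m) * X 3 ^ m - X 0 ^ (2*q+1) * X 3 ^ (2*m)

noncomputable def moduleLength (R M : Type*) [Ring R] [AddCommGroup M] [Module R M] :
    WithBot ℕ∞ :=
  Order.krullDim (Submodule R M)

/-- first coordinate -/
def crd0 (q m a b c : ℕ) : ℕ := (2*q+1+2*m)*a + (2*q+1+m)*b + (2*q+1)*c

/-- second coordinate -/
def crd1 (q m b c e : ℕ) : ℕ := m*b + 2*m*c + (2*q+1+2*m)*e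

lemma crd_normal (q m a b c e : ℕ) : ∃ a' b' c' e', b' ≤ 1 ∧ b' + 2*c' < 2*q+1+2*m ∧
    crd0 q m a b c = crd0 q m a' b' c' ∧ crd1 q m b c e = crd1 q m b' c' e' := by
  have hD : 0 < 2*q+1+2*m := by omega
  obtain ⟨t, ht⟩ : ∃ t, t = (b+2*c) / (2*q+1+2*m) := ⟨_, rfl⟩
  obtain ⟨r, hr⟩ : ∃ r, r = (b+2*c) % (2*q+1+2*m) := ⟨_, rfl⟩
  have h1 : (2*q+1+2*m) * t + r = b + 2*c := by
    rw [ht, hr]; exact Nat.div_add_mod _ _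
  have h2 : r < 2*q+1+2*m := by rw [hr]; exact Nat.mod_lt _ hD
  have h3 : r % 2 + 2 * (r/2) = r := Nat.mod_add_div _ _
  have h4 : ∃ a', a' + m*t + r % 2 + r/2 = a + b + c := by
    refine ⟨a + b + c - (m*t + r % 2 + r/2), ?_⟩
    have : 2*(q*t) + t + 2*(m*t) + r = b + 2*c := by rw [← h1]; ring
    have h5 : t = 0 → q * t = 0 := by rintro rfl; simp
    omega
  obtain ⟨a', ha'⟩ := h4
  refine ⟨a', r % 2, r / 2, e + m*t, by omega, by omega, ?_, ?_⟩
  · unfold crd0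
    generalize r % 2 = u at *
    generalize r / 2 = v at *
    subst h3
    zify at *
    linear_combination (-(2*q+1+2*m:ℤ)) * ha' + (m:ℤ) * h1
  · unfold crd1
    generalize r % 2 = u at *
    generalize r / 2 = v at *
    subst h3
    zify at *
    linear_combination (-(m:ℤ)) * h1

lemma crd_cancel (q m : ℕ) (hco : Nat.Coprime (2*q+1) m) (a b c e a' b' c' e' : ℕ)
    (h0 : crd0 q m a b c = crd0 q m a' b' c' + (2*q+1+2*m))
    (h1 : crd1 q m b c e + (2*q+1+2*m) = crd1 q m b' c' e') :
    ∃ a₁ b₁ c₁ e₁, crd0 q m a b c = crd0 q m (a₁+1) b₁ c₁ ∧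
      crd1 q m b c e = crd1 q m b₁ c₁ e₁ := by
  obtain ⟨a₁, b₁, c₁, e₁, hb, hbc, s0, s1⟩ := crd_normal q m a b c e
  obtain ⟨a₂, b₂, c₂, e₂, hb', hbc', t0, t1⟩ := crd_normal q m a' b' c' e'
  have hD : 0 < 2*q+1+2*m := by omega
  rw [s0, t0] at h0
  rw [s1, t1] at h1
  have hcop : Nat.Coprime (2*q+1+2*m) m := by simpa using hco
  have hmod : m * (b₁ + 2*c₁) ≡ m * (b₂ + 2*c₂) [MOD (2*q+1+2*m)] := by
    have : m * (b₁ + 2*c₁) + (2*q+1+2*m)*(e₁+1) = m * (b₂ + 2*c₂) + (2*q+1+2*m)*e₂ := by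
      unfold crd1 at h1; linarith
    have h := congrArg (· % (2*q+1+2*m)) this
    simpa [Nat.ModEq, Nat.add_mul_mod_self_left] using h
  have hn : b₁ + 2*c₁ = b₂ + 2*c₂ :=
    Nat.ModEq.eq_of_lt_of_lt (Nat.ModEq.cancel_left_of_coprime hcop hmod) hbc hbc'
  obtain rfl : b₁ = b₂ := by omega
  obtain rfl : c₁ = c₂ := by omega
  have : a₁ = a₂ + 1 := by
    unfold crd0 at h0
    apply Nat.eq_of_mul_eq_mul_left hD
    linarith
  subst this
  exact ⟨a₂, b₁, c₁, e₁, s0, s1⟩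

/-- exponent of the image of a monomial -/
noncomputable def expo (q m : ℕ) (v : Fin 4 →₀ ℕ) : Fin 2 →₀ ℕ :=
  Finsupp.single 0 (crd0 q m (v 0) (v 1) (v 2)) + Finsupp.single 1 (crd1 q m (v 1) (v 2) (v 3))

lemma curveMap_monomial (k : Type*) [Field k] (q m : ℕ) (v : Fin 4 →₀ ℕ) (r : k) :
    curveMap k q m (monomial v r) = monomial (expo q m v) r := by
  rw [curveMap, aeval_monomial, Finsupp.prod_fintype _ _ (by simp), Fin.prod_univ_four,
    monomial_eq, Finsupp.prod_fintype _ _ (by simp), Fin.prod_univ_two]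
  simp [expo, crd0, crd1, algebraMap_eq]
  left
  ring

lemma curveMap_support (k : Type*) [Field k] (q m : ℕ) (f : MvPolynomial (Fin 4) k)
    (s : Fin 2 →₀ ℕ) (hs : coeff s (curveMap k q m f) ≠ 0) : ∃ v, s = expo q m v := by
  by_contra hcon
  push Not at hcon
  apply hs
  rw [f.as_sum, map_sum, coeff_sum]
  refine Finset.sum_eq_zero fun v _ => ?_
  rw [curveMap_monomial, coeff_monomial, if_neg (fun h => hcon v h.symm)]

lemma curveMap_X0 (k : Type*) [Field k] (q m : ℕ) :
    curveMap k q m (X 0) = monomial (Finsupp.single 0 (2*q+1+2*m)) 1 := by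
  simp [curveMap, X_pow_eq_monomial]

lemma curveMap_X3 (k : Type*) [Field k] (q m : ℕ) :
    curveMap k q m (X 3) = monomial (Finsupp.single 1 (2*q+1+2*m)) 1 := by
  simp [curveMap, X_pow_eq_monomial]

lemma curve_key (k : Type*) [Field k] (q m : ℕ) (hco : Nat.Coprime (2*q+1) m)
    (f g : MvPolynomial (Fin 4) k)
    (h : curveMap k q m (X 3 * f) = curveMap k q m (X 0 * g)) :
    ∃ u, curveMap k q m f = curveMap k q m (X 0 * u) := by
  have key : ∀ s, coeff s (curveMap k q m f) ≠ 0 →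
      ∃ w, s = expo q m (w + Finsupp.single 0 1) := by
    intro s hs
    obtain ⟨v, rfl⟩ := curveMap_support k q m f s hs
    rw [map_mul, map_mul, curveMap_X0, curveMap_X3] at h
    have h1 := congrArg (coeff (Finsupp.single 1 (2*q+1+2*m) + expo q m v)) h
    rw [coeff_monomial_mul, one_mul, coeff_monomial_mul'] at h1
    split_ifs at h1 with hle
    · rw [one_mul] at h1
      rw [h1] at hs
      obtain ⟨v', hv'⟩ := curveMap_support k q m g _ hs
      have hE := tsub_add_cancel_of_le hle
      rw [hv'] at hE
      have e0 := DFunLike.congr_fun hE 0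
      have e1 := DFunLike.congr_fun hE 1
      simp [expo] at e0 e1
      obtain ⟨a, b, c, e, i0, i1⟩ := crd_cancel q m hco _ _ _ _ _ _ _ _ e0.symm
        (by rw [add_comm]; exact e1.symm)
      refine ⟨Finsupp.equivFunOnFinite.symm ![a, b, c, e], ?_⟩
      simp [expo, i0, i1]
    · exact absurd h1 hs
  choose! w hw using key
  refine ⟨∑ s ∈ (curveMap k q m f).support, monomial (w s) (coeff s (curveMap k q m f)), ?_⟩
  rw [Finset.mul_sum, map_sum]
  conv_lhs => rw [(curveMap k q m f).as_sum]
  refine Finset.sum_congr rfl fun s hs => ?_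
  rw [mem_support_iff] at hs
  have : (X 0 : MvPolynomial (Fin 4) k) * monomial (w s) (coeff s (curveMap k q m f)) =
      monomial (w s + Finsupp.single 0 1) (coeff s (curveMap k q m f)) := by
    rw [monomial_add_single, pow_one, mul_comm]
  rw [this, curveMap_monomial, ← hw s hs]

lemma curve_constantCoeff (k : Type*) [Field k] (q m : ℕ) (hm : 1 ≤ m)
    (f : MvPolynomial (Fin 4) k) :
    constantCoeff (curveMap k q m f) = constantCoeff f := by
  have hm' : m ≠ 0 := by omega
  have : (constantCoeff.comp (curveMap k q m : MvPolynomial (Fin 4) k →+* MvPolynomial (Fin 2) k)) =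
      (constantCoeff : MvPolynomial (Fin 4) k →+* k) := by
    apply MvPolynomial.ringHom_ext
    · intro r; simp [curveMap, algebraMap_eq]
    · intro i; fin_cases i <;> simp [curveMap, hm']
  exact RingHom.congr_fun this f

lemma mem_smul_top (k : Type*) [Field k] (q m : ℕ) (f : MvPolynomial (Fin 4) k)
    (J : Ideal (MvPolynomial (Fin 4) k)) :
    Ideal.Quotient.mk (curveIdeal k q m) f ∈
      (J • ⊤ : Submodule (MvPolynomial (Fin 4) k) (MvPolynomial (Fin 4) k ⧸ curveIdeal k q m)) ↔
      ∃ g ∈ J, f - g ∈ curveIdeal k q m := by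
  rw [Ideal.smul_top_eq_map, Submodule.restrictScalars_mem, Ideal.Quotient.algebraMap_eq,
    Ideal.mem_map_iff_of_surjective _ Ideal.Quotient.mk_surjective]
  constructor
  · rintro ⟨g, hg, h⟩
    exact ⟨g, hg, Ideal.Quotient.eq.mp h.symm⟩
  · rintro ⟨g, hg, h⟩
    exact ⟨g, hg, (Ideal.Quotient.eq.mpr h).symm⟩

lemma curve_regular (k : Type*) [Field k] (q m : ℕ) (hm : 1 ≤ m)
    (hco : Nat.Coprime (2*q+1) m) :
    RingTheory.Sequence.IsRegular (MvPolynomial (Fin 4) k ⧸ curveIdeal k q m)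
      [(X 0 : MvPolynomial (Fin 4) k), X 3] := by
  refine ⟨⟨?_⟩, ?_⟩
  · intro i hi
    rw [isSMulRegular_quotient_iff_mem_of_smul_mem]
    intro y hy
    obtain ⟨f, rfl⟩ := Ideal.Quotient.mk_surjective y
    have hsm : ∀ r : MvPolynomial (Fin 4) k, r • Ideal.Quotient.mk (curveIdeal k q m) f =
        Ideal.Quotient.mk (curveIdeal k q m) (r * f) := fun r => rfl
    rw [hsm, mem_smul_top] at hy
    rw [mem_smul_top]
    obtain ⟨g, hg, h⟩ := hy
    rw [curveIdeal, RingHom.mem_ker, map_sub, sub_eq_zero] at h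
    have hi' : i = 0 ∨ i = 1 := by
      simp at hi; omega
    rcases hi' with rfl | rfl
    · simp at hg h
      subst hg
      refine ⟨0, by simp, ?_⟩
      rw [curveIdeal, RingHom.mem_ker, sub_zero]
      rw [map_zero, curveMap_X0] at h
      simpa using h
    · simp [Ideal.mem_span_singleton] at hg h
      obtain ⟨g, rfl⟩ := hg
      obtain ⟨u, hu⟩ := curve_key k q m hco f g (by simpa using h)
      refine ⟨X 0 * u, by simp [Ideal.mem_span_singleton], ?_⟩
      rw [curveIdeal, RingHom.mem_ker, map_sub, hu, sub_self]
  · intro h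
    have h1 : Ideal.Quotient.mk (curveIdeal k q m) 1 ∈
      (⊤ : Submodule (MvPolynomial (Fin 4) k) (MvPolynomial (Fin 4) k ⧸ curveIdeal k q m)) :=
      Submodule.mem_top
    rw [h, mem_smul_top] at h1
    obtain ⟨g, hg, h1⟩ := h1
    rw [curveIdeal, RingHom.mem_ker] at h1
    have h2 := curve_constantCoeff k q m hm (1 - g)
    rw [h1] at h2
    have h3 : constantCoeff g = 0 := by
      have : Ideal.ofList [(X 0 : MvPolynomial (Fin 4) k), X 3] ≤ RingHom.ker constantCoeff := by
        simp [Ideal.span_le]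
      exact this hg
    simp [h3] at h2

lemma curve_isIntegral (k : Type*) [Field k] (q m : ℕ) :
    ((Ideal.Quotient.mk (curveIdeal k q m)).comp
      (rename ![0, 3] : MvPolynomial (Fin 2) k →ₐ[k] MvPolynomial (Fin 4) k).toRingHom).IsIntegral := by
  set β := ((Ideal.Quotient.mk (curveIdeal k q m)).comp
      (rename ![0, 3] : MvPolynomial (Fin 2) k →ₐ[k] MvPolynomial (Fin 4) k).toRingHom) with hβ
  have b0 : β (X 0) = Ideal.Quotient.mk _ (X 0) := by simp [hβ]
  have b1 : β (X 1) = Ideal.Quotient.mk _ (X 3) := by simp [hβ]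
  have hpow : ∀ (y) (n : ℕ), 0 < n → β.IsIntegralElem (y ^ n) → β.IsIntegralElem y := by
    intro y n hn h
    let _ := β.toAlgebra
    exact IsIntegral.of_pow hn h
  have hX : ∀ i, β.IsIntegralElem (Ideal.Quotient.mk _ (X i)) := by
    intro i
    fin_cases i
    · exact b0 ▸ β.isIntegralElem_map
    · apply hpow _ (2*q+1+2*m) (by omega)
      have : (Ideal.Quotient.mk (curveIdeal k q m) (X 1)) ^ (2*q+1+2*m) =
          β (X 0 ^ (2*q+1+m) * X 1 ^ m) := by
        rw [map_mul, map_pow, map_pow, b0, b1, ← map_pow, ← map_pow, ← map_pow, ← map_mul,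
          Ideal.Quotient.eq, curveIdeal, RingHom.mem_ker]
        simp [curveMap]
        ring
      exact this ▸ β.isIntegralElem_map
    · apply hpow _ (2*q+1+2*m) (by omega)
      have : (Ideal.Quotient.mk (curveIdeal k q m) (X 2)) ^ (2*q+1+2*m) =
          β (X 0 ^ (2*q+1) * X 1 ^ (2*m)) := by
        rw [map_mul, map_pow, map_pow, b0, b1, ← map_pow, ← map_pow, ← map_pow, ← map_mul,
          Ideal.Quotient.eq, curveIdeal, RingHom.mem_ker]
        simp [curveMap]
        ring
      exact this ▸ β.isIntegralElem_map
    · exact b1 ▸ β.isIntegralElem_map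
  intro y
  obtain ⟨f, rfl⟩ := Ideal.Quotient.mk_surjective y
  induction f using MvPolynomial.induction_on with
  | C a =>
    have : Ideal.Quotient.mk (curveIdeal k q m) (C a) = β (C a) := by simp [hβ]
    exact this ▸ β.isIntegralElem_map
  | add p q hp hq => rw [map_add]; exact hp.add β hq
  | mul_X p i hp => rw [map_mul]; exact hp.mul β (hX i)

lemma curve_dim_le (k : Type*) [Field k] (q m : ℕ) :
    ringKrullDim (MvPolynomial (Fin 4) k ⧸ curveIdeal k q m) ≤ 2 := by
  have hint := curve_isIntegral k q m
  set β := ((Ideal.Quotient.mk (curveIdeal k q m)).comp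
      (rename ![0, 3] : MvPolynomial (Fin 2) k →ₐ[k] MvPolynomial (Fin 4) k).toRingHom) with hβ
  have h2 : ringKrullDim (MvPolynomial (Fin 2) k) = 2 := by simp
  rw [← h2]
  let _ := β.toAlgebra
  have : Algebra.IsIntegral (MvPolynomial (Fin 2) k) (MvPolynomial (Fin 4) k ⧸ curveIdeal k q m) := ⟨hint⟩
  refine Order.krullDim_le_of_strictMono (PrimeSpectrum.comap β) ?_
  intro P Q hPQ
  exact Ideal.IsIntegral.comap_lt_comap hPQ

lemma two_le_dim {A : Type*} [CommRing A] {P0 P1 P2 : PrimeSpectrum A} (h01 : P0 < P1)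
    (h12 : P1 < P2) : 2 ≤ ringKrullDim A := by
  let s : LTSeries (PrimeSpectrum A) :=
    ⟨2, ![P0, P1, P2], fun i => by fin_cases i <;> [exact h01; exact h12]⟩
  have h : ((2 : ℕ) : WithBot ℕ∞) ≤ ringKrullDim A := le_iSup (fun p : LTSeries (PrimeSpectrum A) => (p.length : WithBot ℕ∞)) s
  exact_mod_cast h

lemma curve_le_dim (k : Type*) [Field k] (q m : ℕ) (hm : 1 ≤ m) :
    2 ≤ ringKrullDim (MvPolynomial (Fin 4) k ⧸ curveIdeal k q m) := by
  have hm' : m ≠ 0 := by omega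
  obtain ⟨ψ, hψ⟩ : ∃ ψ : (MvPolynomial (Fin 4) k ⧸ curveIdeal k q m) →+* MvPolynomial (Fin 2) k,
      ∀ f, ψ (Ideal.Quotient.mk _ f) = curveMap k q m f :=
    ⟨Ideal.Quotient.lift _ (curveMap k q m : MvPolynomial (Fin 4) k →+* MvPolynomial (Fin 2) k)
      (fun _ h => h), fun f => rfl⟩
  let ev : MvPolynomial (Fin 2) k →+* MvPolynomial (Fin 2) k :=
    (aeval ![0, X 1] : MvPolynomial (Fin 2) k →ₐ[k] MvPolynomial (Fin 2) k)
  have hev : ∀ f, constantCoeff (ev f) = constantCoeff f := by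
    intro f
    have : (constantCoeff.comp ev) = (constantCoeff : MvPolynomial (Fin 2) k →+* k) := by
      apply MvPolynomial.ringHom_ext
      · intro r; simp [ev, algebraMap_eq]
      · intro i; fin_cases i <;> simp [ev]
    exact RingHom.congr_fun this f
  let P0 : PrimeSpectrum (MvPolynomial (Fin 4) k ⧸ curveIdeal k q m) := ⟨RingHom.ker ψ, RingHom.ker_isPrime _⟩
  let P1 : PrimeSpectrum (MvPolynomial (Fin 4) k ⧸ curveIdeal k q m) :=
    ⟨RingHom.ker (ev.comp ψ), RingHom.ker_isPrime _⟩
  let P2 : PrimeSpectrum (MvPolynomial (Fin 4) k ⧸ curveIdeal k q m) :=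
    ⟨RingHom.ker (constantCoeff.comp ψ), RingHom.ker_isPrime _⟩
  have h01 : P0 < P1 := by
    refine lt_of_le_not_ge ?_ ?_
    · intro x hx
      have hx' : ψ x = 0 := hx
      change ev (ψ x) = 0
      rw [hx', map_zero]
    · intro hle
      have hx : Ideal.Quotient.mk _ (X 0) ∈ P1.asIdeal := by
        change ev (ψ _) = 0
        rw [hψ]
        simp [curveMap, ev]
      have hx' : ψ (Ideal.Quotient.mk _ (X 0)) = 0 := hle hx
      rw [hψ, curveMap_X0] at hx'
      simp at hx'
  have h12 : P1 < P2 := by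
    refine lt_of_le_not_ge ?_ ?_
    · intro x hx
      have hx' : ev (ψ x) = 0 := hx
      change constantCoeff (ψ x) = 0
      rw [← hev, hx', map_zero]
    · intro hle
      have hx : Ideal.Quotient.mk _ (X 3) ∈ P2.asIdeal := by
        change constantCoeff (ψ _) = 0
        rw [hψ]
        simp [curveMap]
      have hx' : ev (ψ (Ideal.Quotient.mk _ (X 3))) = 0 := hle hx
      rw [hψ] at hx'
      simp [curveMap, ev] at hx'
  exact two_le_dim h01 h12

/-- The sequence `x₁, x₄` is a regular sequence on `R/𝔭`; in particular,
`R/𝔭` is a two-dimensional Cohen–Macaulay ring (here expressed as: the Krull dimension of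
`R/𝔭` is `2` and it admits the regular sequence `x₁, x₄` of that length). -/
theorem statement0 (k : Type*) [Field k] (q m : ℕ) (hq : 1 ≤ q) (hm : 1 ≤ m)
    (hco : Nat.Coprime (2*q+1) m) :
    RingTheory.Sequence.IsRegular (MvPolynomial (Fin 4) k ⧸ curveIdeal k q m)
      [(X 0 : MvPolynomial (Fin 4) k), X 3] ∧
    ringKrullDim (MvPolynomial (Fin 4) k ⧸ curveIdeal k q m) = 2 := by
  exact ⟨curve_regular k q m hm hco, le_antisymm (curve_dim_le k q m) (curve_le_dim k q m hm)⟩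
end

section
/- For all n ≥ 1, the sequence x₁, x₄ is a regular sequence on R/𝔭^{(n)}; in particular R/𝔭^{(n)} is Cohen–Macaulay. -/
open MvPolynomial

/-- Krull dimension is preserved along finite faithfully flat algebras. -/
lemma ringKrullDim_eq_of_finite_faithfullyFlat (A S : Type*) [CommRing A] [CommRing S]
    [Algebra A S] [Module.Finite A S] [Module.FaithfullyFlat A S] :
    ringKrullDim S = ringKrullDim A := by
  apply le_antisymm
  · refine Order.krullDim_le_of_strictMono (PrimeSpectrum.comap (algebraMap A S)) ?_
    intro P Q h
    exact Ideal.IsIntegral.comap_lt_comap (R := A) (I := P.asIdeal) (J := Q.asIdeal) h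
  · refine iSup_le fun l => ?_
    obtain ⟨⟨P, hP⟩, hPl⟩ :=
      PrimeSpectrum.comap_surjective_of_faithfullyFlat (A := A) (B := S) l.head
    have hP' := hP
    have : P.LiesOver (RelSeries.head l).asIdeal := ⟨by rw [← hPl]; rfl⟩
    obtain ⟨L, hL, -, -⟩ := Ideal.exists_ltSeries_of_hasGoingUp l P
    rw [← hL]
    exact le_iSup (fun L : LTSeries (PrimeSpectrum S) => (L.length : WithBot ℕ∞)) L

lemma isRegular_X_two (k : Type*) [Field k] :
    RingTheory.Sequence.IsRegular (MvPolynomial (Fin 2) k)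
      [(X 0 : MvPolynomial (Fin 2) k), X 1] := by
  refine ⟨?_, ?_⟩
  · rw [RingTheory.Sequence.isWeaklyRegular_cons_iff,
      RingTheory.Sequence.isWeaklyRegular_singleton_iff]
    constructor
    · intro a b h
      exact mul_left_cancel₀ (X_ne_zero 0) h
    · rw [isSMulRegular_iff_right_eq_zero_of_smul]
      intro x hx
      obtain ⟨a, rfl⟩ := Submodule.Quotient.mk_surjective _ x
      rw [← Submodule.Quotient.mk_smul, Submodule.Quotient.mk_eq_zero,
        Submodule.mem_smul_pointwise_iff_exists] at hx
      rw [Submodule.Quotient.mk_eq_zero, Submodule.mem_smul_pointwise_iff_exists]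
      obtain ⟨b, -, hb⟩ := hx
      have h1 : (X 0 : MvPolynomial (Fin 2) k) ∣ X 1 * a := ⟨b, hb.symm⟩
      rcases (X_prime (R := k) (i := (0 : Fin 2))).dvd_or_dvd h1 with h | h
      · rw [X_dvd_X] at h
        simp at h
      · obtain ⟨c, hc⟩ := h
        exact ⟨c, trivial, hc.symm⟩
  · intro h
    have h1 : (1 : MvPolynomial (Fin 2) k) ∈
        Ideal.ofList [(X 0 : MvPolynomial (Fin 2) k), X 1] • (⊤ : Ideal (MvPolynomial (Fin 2) k)) := by
      rw [← h]; trivial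
    have h2 : Ideal.ofList [(X 0 : MvPolynomial (Fin 2) k), X 1] • (⊤ : Ideal (MvPolynomial (Fin 2) k))
        ≤ RingHom.ker (constantCoeff (R := k) (σ := Fin 2)) := by
      rw [smul_eq_mul, Ideal.mul_top]
      simp [Ideal.ofList_cons, Ideal.span_le, RingHom.mem_ker]
    have := h2 h1
    simp [RingHom.mem_ker] at this

/-- The weighted filtration by `(h, Y)` on `B[Y]`. -/
def weightIdeal {B : Type*} [CommRing B] (h : B) (n : ℕ) : Ideal (Polynomial B) where
  carrier := {w | ∀ j, h ^ (n - j) ∣ w.coeff j}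
  zero_mem' := by intro j; simp
  add_mem' := by
    intro a b ha hb j
    rw [Polynomial.coeff_add]
    exact dvd_add (ha j) (hb j)
  smul_mem' := by
    intro c w hw j
    rw [smul_eq_mul, Polynomial.coeff_mul]
    refine Finset.dvd_sum fun x hx => ?_
    rw [Finset.HasAntidiagonal.mem_antidiagonal] at hx
    exact Dvd.dvd.mul_left ((pow_dvd_pow h (by omega)).trans (hw x.2)) _

lemma mem_weightIdeal {B : Type*} [CommRing B] (h : B) (n : ℕ) (w : Polynomial B) :
    w ∈ weightIdeal h n ↔ ∀ j, h ^ (n - j) ∣ w.coeff j := Iff.rfl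

lemma mem_weightIdeal_one {B : Type*} [CommRing B] (h : B) (w : Polynomial B) :
    w ∈ weightIdeal h 1 ↔ h ∣ w.coeff 0 := by
  rw [mem_weightIdeal]
  constructor
  · intro H; simpa using H 0
  · intro H j
    rcases j with _ | j
    · simpa using H
    · simp

lemma weightIdeal_mul_mem {B : Type*} [CommRing B] (h : B) (a b : ℕ) {w z : Polynomial B}
    (hw : w ∈ weightIdeal h a) (hz : z ∈ weightIdeal h b) : w * z ∈ weightIdeal h (a + b) := by
  intro j
  rw [Polynomial.coeff_mul]
  refine Finset.dvd_sum fun x hx => ?_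
  rw [Finset.HasAntidiagonal.mem_antidiagonal] at hx
  have h1 := mul_dvd_mul (hw x.1) (hz x.2)
  rw [← pow_add] at h1
  exact (pow_dvd_pow h (by omega)).trans h1

lemma weightIdeal_of_mul {B : Type*} [CommRing B] [IsDomain B] {h : B} (hp : Prime h) (n : ℕ)
    {s w : Polynomial B} (hs : ¬ h ∣ s.coeff 0) (hsw : s * w ∈ weightIdeal h n) :
    w ∈ weightIdeal h n := by
  intro j
  induction j using Nat.strong_induction_on with
  | _ j ih =>
    have h1 := hsw j
    rw [Polynomial.coeff_mul, Finset.Nat.antidiagonal_eq_map, Finset.sum_map,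
      Finset.sum_range_succ'] at h1
    have h2 : h ^ (n - j) ∣ ∑ x ∈ Finset.range j, s.coeff (x + 1) * w.coeff (j - (x + 1)) := by
      refine Finset.dvd_sum fun x hx => ?_
      rw [Finset.mem_range] at hx
      exact Dvd.dvd.mul_left ((pow_dvd_pow h (by omega)).trans (ih (j - (x + 1)) (by omega))) _
    have h3 := (dvd_add_right h2).mp h1
    exact hp.pow_dvd_of_dvd_mul_left _ hs h3

lemma weightIdeal_of_X_mul {B : Type*} [CommRing B] (h : B) (n : ℕ)
    {w : Polynomial B} (hw : Polynomial.X * w ∈ weightIdeal h (n + 1)) :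
    w ∈ weightIdeal h n := by
  intro j
  have := hw (j + 1)
  rwa [Polynomial.coeff_X_mul, Nat.add_sub_add_right] at this

/-- The base ring `A = k[x₁, x₄]`. -/
abbrev BaseRing (k : Type*) [Field k] := MvPolynomial (Fin 2) k

/-- The fraction field of `A`. -/
abbrev BaseField (k : Type*) [Field k] := FractionRing (MvPolynomial (Fin 2) k)

/-- The embedding of `A` in `R`. -/
noncomputable def baseMap (k : Type*) [Field k] :
    MvPolynomial (Fin 2) k →ₐ[k] MvPolynomial (Fin 4) k :=
  aeval ![X 0, X 3]

noncomputable instance baseAlgebra (k : Type*) [Field k] :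
    Algebra (MvPolynomial (Fin 2) k) (MvPolynomial (Fin 4) k) :=
  (baseMap k).toRingHom.toAlgebra

lemma algebraMap_base (k : Type*) [Field k] (a : MvPolynomial (Fin 2) k) :
    algebraMap (MvPolynomial (Fin 2) k) (MvPolynomial (Fin 4) k) a = baseMap k a := rfl

/-- The map `R → K[u][Y]` sending `x₂` to `u` and `x₂² - x₁ x₃` to `Y`. -/
noncomputable def theta (k : Type*) [Field k] :
    MvPolynomial (Fin 4) k →+* Polynomial (Polynomial (BaseField k)) :=
  eval₂Hom ((Polynomial.C.comp Polynomial.C).comp ((algebraMap (BaseRing k) (BaseField k)).comp C))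
    ![Polynomial.C (Polynomial.C (algebraMap (BaseRing k) (BaseField k) (X 0))),
      Polynomial.C Polynomial.X,
      Polynomial.C (Polynomial.C (algebraMap (BaseRing k) (BaseField k) (X 0))⁻¹)
        * (Polynomial.C (Polynomial.X ^ 2) - Polynomial.X),
      Polynomial.C (Polynomial.C (algebraMap (BaseRing k) (BaseField k) (X 1)))]

lemma algebraMap_X_ne_zero (k : Type*) [Field k] (i : Fin 2) :
    algebraMap (BaseRing k) (BaseField k) (X i) ≠ 0 := by
  rw [Ne, map_eq_zero_iff _ (IsFractionRing.injective _ _)]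
  exact X_ne_zero i

lemma theta_algebraMap (k : Type*) [Field k] (a : MvPolynomial (Fin 2) k) :
    theta k (algebraMap (MvPolynomial (Fin 2) k) (MvPolynomial (Fin 4) k) a) =
      Polynomial.C (Polynomial.C (algebraMap (BaseRing k) (BaseField k) a)) := by
  rw [algebraMap_base]
  have : (theta k).comp (baseMap k).toRingHom =
      (Polynomial.C.comp Polynomial.C).comp (algebraMap (BaseRing k) (BaseField k)) := by
    apply MvPolynomial.ringHom_ext
    · intro r
      simp [theta, baseMap]
    · intro i
      fin_cases i <;> simp [theta, baseMap]
  exact congrArg (fun f => f a) this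

/-- The quadric `x₂² - x₁ x₃`. -/
noncomputable def gPoly (k : Type*) [Field k] : MvPolynomial (Fin 4) k := X 1 ^ 2 - X 0 * X 2

lemma theta_gPoly (k : Type*) [Field k] : theta k (gPoly k) = Polynomial.X := by
  have h0 := algebraMap_X_ne_zero k 0
  simp only [theta, gPoly, map_sub, map_mul, map_pow, coe_eval₂Hom, eval₂_X, Matrix.cons_val]
  rw [← mul_assoc, ← map_mul, ← map_mul, mul_inv_cancel₀ h0]
  simp only [map_one, one_mul]
  ring

/-- The minimal polynomial of `x₂` over `K`. -/
noncomputable def hPoly (k : Type*) [Field k] (q m : ℕ) : Polynomial (BaseField k) :=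
  Polynomial.X ^ (2*q+1+2*m) -
    Polynomial.C (algebraMap (BaseRing k) (BaseField k) (X 0 ^ (2*q+1+m) * X 1 ^ m))

lemma hPoly_irreducible (k : Type*) [Field k] (q m : ℕ) (hco : Nat.Coprime (2*q+1) m) :
    Irreducible (hPoly k q m) := by
  refine X_pow_sub_C_irreducible_of_odd ⟨q + m, by ring⟩ ?_
  intro p hp hpd b hb
  obtain ⟨a, rfl⟩ : ∃ a, algebraMap (BaseRing k) (BaseField k) a = b := by
    refine IsIntegrallyClosed.exists_algebraMap_eq_of_isIntegral_pow hp.pos (x := b) ?_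
    rw [hb]
    exact isIntegral_algebraMap
  rw [← map_pow] at hb
  have hb' : a ^ p = X 0 ^ (2*q+1+m) * X 1 ^ m := IsFractionRing.injective _ _ hb
  have hpr : Prime (X 1 : MvPolynomial (Fin 2) k) := X_prime
  have hnd : ¬ (X 1 : MvPolynomial (Fin 2) k) ∣ X 0 ^ (2*q+1+m) := by
    intro h
    have := hpr.dvd_of_dvd_pow h
    rw [X_dvd_X] at this
    simp at this
  have h1 := congrArg (emultiplicity (X 1 : MvPolynomial (Fin 2) k)) hb'
  rw [emultiplicity_pow hpr, emultiplicity_mul hpr, emultiplicity_eq_zero.mpr hnd, zero_add,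
    emultiplicity_pow_self hpr.ne_zero hpr.not_isUnit] at h1
  have h2 : p ∣ m := by
    cases h3 : emultiplicity (X 1 : MvPolynomial (Fin 2) k) a with
    | top =>
      rw [h3, ENat.mul_top (by exact_mod_cast hp.ne_zero)] at h1
      exact absurd h1 (by simp)
    | coe c =>
      rw [h3] at h1
      exact ⟨c, by exact_mod_cast h1.symm⟩
  have h3 : p ∣ 2*q+1 := by
    have : p ∣ 2 * m := h2.mul_left 2
    exact (Nat.dvd_add_left this).mp hpd
  exact hp.one_lt.ne' (Nat.dvd_one.mp (hco ▸ Nat.dvd_gcd h3 h2))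

/-- The target field. -/
noncomputable def fieldMap (k : Type*) [Field k] (D : ℕ) (hD : 0 < D) :
    BaseField k →+* FractionRing (MvPolynomial (Fin 2) k) :=
  IsFractionRing.lift (A := BaseRing k)
    (g := (algebraMap (MvPolynomial (Fin 2) k) (FractionRing (MvPolynomial (Fin 2) k))).comp
      (expand (σ := Fin 2) (R := k) D).toRingHom)
    ((IsFractionRing.injective _ _).comp (expand_injective hD))

lemma mem_curveIdeal_iff (k : Type*) [Field k] (q m : ℕ) (hco : Nat.Coprime (2*q+1) m)
    (w : MvPolynomial (Fin 4) k) :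
    w ∈ curveIdeal k q m ↔ hPoly k q m ∣ (theta k w).coeff 0 := by
  let L := FractionRing (MvPolynomial (Fin 2) k)
  have hD : 0 < 2*q+1+2*m := by omega
  have hfm : ∀ a, fieldMap k _ hD (algebraMap (BaseRing k) (BaseField k) a) =
      algebraMap (MvPolynomial (Fin 2) k) L (expand (2*q+1+2*m) a) := by
    intro a
    exact IsFractionRing.lift_algebraMap _ a
  let psi : Polynomial (BaseField k) →+* L :=
    Polynomial.eval₂RingHom (fieldMap k _ hD)
      (algebraMap (MvPolynomial (Fin 2) k) L (X 0 ^ (2*q+1+m) * X 1 ^ m))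
  have hx0 : algebraMap (MvPolynomial (Fin 2) k) L (X 0) ≠ 0 := algebraMap_X_ne_zero k 0
  have hcomp : (psi.comp Polynomial.constantCoeff).comp (theta k) =
      (algebraMap (MvPolynomial (Fin 2) k) L).comp (curveMap k q m).toRingHom := by
    apply MvPolynomial.ringHom_ext
    · intro r
      simp [theta, curveMap, psi, hfm]
    · intro i
      fin_cases i
      · simp [theta, curveMap, psi, hfm]
      · simp [theta, curveMap, psi, hfm]
      · simp [theta, curveMap, psi, hfm]
        rw [inv_mul_eq_iff_eq_mul₀ (pow_ne_zero _ hx0), ← Polynomial.C_pow,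
          Polynomial.coeff_C_zero, Polynomial.eval₂_X_pow]
        ring
      · simp [theta, curveMap, psi, hfm]
  have hpsi : psi (hPoly k q m) = 0 := by
    rw [hPoly, map_sub, map_pow]
    simp only [psi, Polynomial.coe_eval₂RingHom, Polynomial.eval₂_X, Polynomial.eval₂_C, hfm]
    simp only [map_mul, map_pow, expand_X]
    ring
  have hcw : psi ((theta k w).coeff 0) = algebraMap (MvPolynomial (Fin 2) k) L (curveMap k q m w) :=
    congrArg (fun f => f w) hcomp
  have h1 : w ∈ curveIdeal k q m ↔ psi ((theta k w).coeff 0) = 0 := by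
    rw [hcw, map_eq_zero_iff _ (IsFractionRing.injective _ _)]
    rfl
  rw [h1]
  constructor
  · intro h0
    by_contra hnd
    obtain ⟨a, b, hab⟩ := ((hPoly_irreducible k q m hco).coprime_iff_not_dvd).mpr hnd
    have := congrArg psi hab
    rw [map_add, map_mul, map_mul, hpsi, h0] at this
    simp at this
  · rintro ⟨c, hc⟩
    rw [hc, map_mul, hpsi, zero_mul]

lemma mem_symbPow_iff (k : Type*) [Field k] (q m n : ℕ) (w : MvPolynomial (Fin 4) k) :
    w ∈ symbPow k q m n ↔ ∃ s ∉ curveIdeal k q m, s * w ∈ curveIdeal k q m ^ n := by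
  rw [symbPow, Ideal.mem_comap,
    IsLocalization.algebraMap_mem_map_algebraMap_iff (curveIdeal k q m).primeCompl]
  rfl

lemma theta_mem_of_symbPow (k : Type*) [Field k] (q m : ℕ) (hco : Nat.Coprime (2*q+1) m) (n : ℕ)
    (w : MvPolynomial (Fin 4) k) (hw : w ∈ symbPow k q m n) :
    theta k w ∈ weightIdeal (hPoly k q m) n := by
  obtain ⟨s, hs, hsw⟩ := (mem_symbPow_iff k q m n w).mp hw
  have hle : ∀ n, curveIdeal k q m ^ n ≤ (weightIdeal (hPoly k q m) n).comap (theta k) := by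
    intro n
    induction n with
    | zero =>
      intro w _ j
      simp
    | succ n ih =>
      rw [pow_succ, Ideal.mul_le]
      intro r hr s hs
      rw [Ideal.mem_comap, map_mul]
      refine weightIdeal_mul_mem _ _ _ (ih hr) ?_
      rw [mem_weightIdeal_one, ← mem_curveIdeal_iff k q m hco]
      exact hs
  have h1 := hle n hsw
  rw [Ideal.mem_comap, map_mul] at h1
  rw [mem_curveIdeal_iff k q m hco] at hs
  exact weightIdeal_of_mul (hPoly_irreducible k q m hco).prime n hs h1

/-- The basis elements `g^j u^(s%2) v^(s/2)`. -/
noncomputable def basisElt (k : Type*) [Field k] (j s : ℕ) : MvPolynomial (Fin 4) k :=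
  gPoly k ^ j * (X 1 ^ (s % 2) * X 2 ^ (s / 2))

lemma theta_basisElt_coeff (k : Type*) [Field k] (s : ℕ) :
    (theta k (basisElt k 0 s)).coeff 0 =
      Polynomial.C ((algebraMap (BaseRing k) (BaseField k) (X 0))⁻¹ ^ (s / 2)) *
        Polynomial.X ^ s := by
  have h : Polynomial.constantCoeff (theta k (basisElt k 0 s)) =
      Polynomial.X ^ (s % 2) * (Polynomial.C ((algebraMap (BaseRing k) (BaseField k) (X 0))⁻¹) *
        Polynomial.X ^ 2) ^ (s / 2) := by
    simp only [basisElt, pow_zero, one_mul, theta, map_mul, map_pow, coe_eval₂Hom, eval₂_X,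
      Matrix.cons_val, Polynomial.constantCoeff_apply, Polynomial.coeff_C_zero]
    rw [Polynomial.coeff_sub, ← Polynomial.C_pow, Polynomial.coeff_C_zero,
      Polynomial.coeff_X_zero, sub_zero]
  rw [Polynomial.constantCoeff_apply] at h
  rw [h, mul_pow, ← Polynomial.C_pow, ← pow_mul, mul_left_comm, ← pow_add, Nat.mod_add_div]

lemma hPoly_degree (k : Type*) [Field k] (q m : ℕ) :
    (hPoly k q m).natDegree = 2*q+1+2*m := Polynomial.natDegree_X_pow_sub_C

lemma hPoly_monic (k : Type*) [Field k] (q m : ℕ) : (hPoly k q m).Monic :=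
  Polynomial.monic_X_pow_sub_C _ (by omega)

lemma basisElt_indep (k : Type*) [Field k] (q m n : ℕ) (c : ℕ → ℕ → MvPolynomial (Fin 2) k)
    (H : theta k (∑ j ∈ Finset.range n, ∑ s ∈ Finset.range ((2*q+1+2*m) * (n - j)),
      c j s • basisElt k j s) ∈ weightIdeal (hPoly k q m) n) :
    ∀ j < n, ∀ s < (2*q+1+2*m) * (n - j), c j s = 0 := by
  induction n generalizing c with
  | zero => intro j hj; omega
  | succ n ih =>
    have hsum : (∑ j ∈ Finset.range (n+1), ∑ s ∈ Finset.range ((2*q+1+2*m) * (n + 1 - j)),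
      c j s • basisElt k j s) = gPoly k * (∑ j ∈ Finset.range n,
        ∑ s ∈ Finset.range ((2*q+1+2*m) * (n - j)), c (j+1) s • basisElt k j s) +
        ∑ s ∈ Finset.range ((2*q+1+2*m) * (n + 1)), c 0 s • basisElt k 0 s := by
      rw [Finset.sum_range_succ', Nat.sub_zero, Finset.mul_sum]
      congr 1
      refine Finset.sum_congr rfl fun j _ => ?_
      rw [Finset.mul_sum, Nat.add_sub_add_right]
      refine Finset.sum_congr rfl fun s _ => ?_
      rw [mul_smul_comm, basisElt, basisElt, pow_succ']
      congr 1
      ring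
    rw [hsum, map_add, map_mul, theta_gPoly] at H
    have hc0 : (theta k (∑ s ∈ Finset.range ((2*q+1+2*m) * (n + 1)), c 0 s • basisElt k 0 s)).coeff 0
        = ∑ s ∈ Finset.range ((2*q+1+2*m) * (n + 1)),
          Polynomial.C (algebraMap (BaseRing k) (BaseField k) (c 0 s) *
            (algebraMap (BaseRing k) (BaseField k) (X 0))⁻¹ ^ (s / 2)) * Polynomial.X ^ s := by
      rw [map_sum, Polynomial.finsetSum_coeff]
      refine Finset.sum_congr rfl fun s _ => ?_
      rw [Algebra.smul_def, map_mul, theta_algebraMap, Polynomial.coeff_C_mul,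
        theta_basisElt_coeff, map_mul, mul_assoc]
    have h0 := H 0
    rw [Polynomial.coeff_add, Polynomial.mul_coeff_zero, Polynomial.coeff_X_zero, zero_mul,
      zero_add, hc0, Nat.sub_zero] at h0
    have hz := Polynomial.eq_zero_of_dvd_of_degree_lt h0 (by
      rw [Polynomial.degree_pow, Polynomial.degree_eq_natDegree (hPoly_monic k q m).ne_zero,
        hPoly_degree, nsmul_eq_mul, ← Nat.cast_mul]
      refine lt_of_le_of_lt (Polynomial.degree_sum_le _ _) ?_
      rw [Finset.sup_lt_iff (WithBot.bot_lt_coe _)]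
      intro s hs
      rw [Finset.mem_range] at hs
      have hs' : s < (n + 1) * (2*q+1+2*m) := by rw [mul_comm]; exact hs
      refine lt_of_le_of_lt (Polynomial.degree_C_mul_X_pow_le _ _) ?_
      exact_mod_cast hs')
    have hc : ∀ s < (2*q+1+2*m) * (n + 1), c 0 s = 0 := by
      intro s hs
      have h1 := congrArg (fun p => Polynomial.coeff p s) hz
      simp only [Polynomial.finsetSum_coeff, Polynomial.coeff_C_mul_X_pow, Polynomial.coeff_zero,
        Finset.sum_ite_eq, Finset.mem_range, if_pos hs] at h1
      rcases mul_eq_zero.mp h1 with h2 | h2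
      · exact (map_eq_zero_iff _ (IsFractionRing.injective _ _)).mp h2
      · exact absurd h2 (pow_ne_zero _ (inv_ne_zero (algebraMap_X_ne_zero k 0)))
    have hT : (∑ s ∈ Finset.range ((2*q+1+2*m) * (n + 1)), c 0 s • basisElt k 0 s) = 0 := by
      refine Finset.sum_eq_zero fun s hs => ?_
      rw [hc s (Finset.mem_range.mp hs), zero_smul]
    rw [hT, map_zero, add_zero] at H
    have H' := ih (fun j s => c (j+1) s) (weightIdeal_of_X_mul _ _ H)
    intro j hj s hs
    rcases j with _ | j
    · exact hc s hs
    · rw [Nat.add_sub_add_right] at hs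
      exact H' j (by omega) s hs

/-- The `A`-span of the monomials in `x₂, x₃` of degree less than `e`. -/
noncomputable def lowSpan (k : Type*) [Field k] (e : ℕ) :
    Submodule (MvPolynomial (Fin 2) k) (MvPolynomial (Fin 4) k) :=
  Submodule.span _ {w | ∃ a b, a + b < e ∧ w = X 1 ^ a * X 2 ^ b}

lemma mono_mem_lowSpan (k : Type*) [Field k] {e a b : ℕ} (h : a + b < e) :
    (X 1 ^ a * X 2 ^ b : MvPolynomial (Fin 4) k) ∈ lowSpan k e :=
  Submodule.subset_span ⟨a, b, h, rfl⟩

lemma lowSpan_mono (k : Type*) [Field k] {e e' : ℕ} (h : e ≤ e') : lowSpan k e ≤ lowSpan k e' := by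
  refine Submodule.span_mono ?_
  rintro w ⟨a, b, hab, rfl⟩
  exact ⟨a, b, by omega, rfl⟩

lemma X0_mul_mem (k : Type*) [Field k] {M : Submodule (MvPolynomial (Fin 2) k) (MvPolynomial (Fin 4) k)}
    {w : MvPolynomial (Fin 4) k} (hw : w ∈ M) (i l : ℕ) : X 0 ^ i * X 3 ^ l * w ∈ M := by
  have := M.smul_mem (X 0 ^ i * X 1 ^ l) hw
  rw [Algebra.smul_def, algebraMap_base] at this
  simpa [baseMap] using this

lemma C_mul_mem (k : Type*) [Field k] {M : Submodule (MvPolynomial (Fin 2) k) (MvPolynomial (Fin 4) k)}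
    {w : MvPolynomial (Fin 4) k} (hw : w ∈ M) (c : k) : C c * w ∈ M := by
  have := M.smul_mem (C c) hw
  rw [Algebra.smul_def, algebraMap_base] at this
  simpa [baseMap] using this

lemma lowSpan_mul (k : Type*) [Field k] {e e' : ℕ} {x y : MvPolynomial (Fin 4) k}
    (hx : x ∈ lowSpan k e) (hy : y ∈ lowSpan k (e' + 1)) : x * y ∈ lowSpan k (e + e') := by
  have h1 := Submodule.mul_mem_mul hx hy
  rw [lowSpan, lowSpan, Submodule.span_mul_span] at h1
  refine Submodule.span_mono ?_ h1
  rintro w ⟨_, ⟨a, b, hab, rfl⟩, _, ⟨a', b', hab', rfl⟩, rfl⟩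
  exact ⟨a + a', b + b', by omega, by ring⟩

/-- `w` has leading monomial `x₂^a x₃^b`. -/
def HasLead (k : Type*) [Field k] (w : MvPolynomial (Fin 4) k) (a b : ℕ) : Prop :=
  w - X 1 ^ a * X 2 ^ b ∈ lowSpan k (a + b)

lemma HasLead.mono (k : Type*) [Field k] (a b : ℕ) :
    HasLead k (X 1 ^ a * X 2 ^ b) a b := by
  rw [HasLead, sub_self]
  exact Submodule.zero_mem _

lemma HasLead.mul {k : Type*} [Field k] {w w' : MvPolynomial (Fin 4) k} {a b a' b' : ℕ}
    (h : HasLead k w a b) (h' : HasLead k w' a' b') : HasLead k (w * w') (a + a') (b + b') := by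
  have e1 : w' ∈ lowSpan k (a' + b' + 1) := by
    have := Submodule.add_mem _ (lowSpan_mono k (Nat.le_succ _) h')
      (mono_mem_lowSpan k (Nat.lt_succ_self (a' + b')))
    simpa using this
  have e2 := mono_mem_lowSpan k (Nat.lt_succ_self (a + b))
  have h1 := lowSpan_mul k h e1
  have h2 := lowSpan_mul k h' e2
  rw [HasLead]
  have h3 := Submodule.add_mem _ h1 (lowSpan_mono k (by omega : a' + b' + (a + b) ≤ a + b + (a' + b')) h2)
  rw [show a + a' + (b + b') = a + b + (a' + b') by ring]
  convert h3 using 1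
  ring

lemma HasLead.pow {k : Type*} [Field k] {w : MvPolynomial (Fin 4) k} {a b : ℕ}
    (h : HasLead k w a b) (l : ℕ) : HasLead k (w ^ l) (a * l) (b * l) := by
  induction l with
  | zero => simpa using HasLead.mono k 0 0
  | succ l ih => exact pow_succ w l ▸ ih.mul h

lemma gPoly_hasLead (k : Type*) [Field k] : HasLead k (gPoly k) 2 0 := by
  have h := X0_mul_mem k (mono_mem_lowSpan k (e := 2) (a := 0) (b := 1) (by norm_num)) 1 0
  have h' := Submodule.neg_mem _ h
  rw [HasLead, gPoly]
  convert h' using 1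
  ring

/-- Second generator. -/
noncomputable def pTwo (k : Type*) [Field k] (q m : ℕ) : MvPolynomial (Fin 4) k :=
  X 1 * X 2 ^ (q + m) - X 0 ^ (q + 1) * X 3 ^ m

/-- Third generator. -/
noncomputable def pThree (k : Type*) [Field k] (q m : ℕ) : MvPolynomial (Fin 4) k :=
  X 2 ^ (q + m + 1) - X 0 ^ q * X 1 * X 3 ^ m

lemma pTwo_hasLead (k : Type*) [Field k] (q m : ℕ) : HasLead k (pTwo k q m) 1 (q + m) := by
  have h := X0_mul_mem k (mono_mem_lowSpan k (e := 1 + (q + m)) (a := 0) (b := 0) (by omega)) (q+1) m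
  have h' := Submodule.neg_mem _ h
  rw [HasLead, pTwo]
  convert h' using 1
  ring

lemma pThree_hasLead (k : Type*) [Field k] (q m : ℕ) (hq : 1 ≤ q) :
    HasLead k (pThree k q m) 0 (q + m + 1) := by
  have h := X0_mul_mem k (mono_mem_lowSpan k (e := 0 + (q + m + 1)) (a := 1) (b := 0) (by omega)) q m
  have h' := Submodule.neg_mem _ h
  rw [HasLead, pThree]
  convert h' using 1
  ring

lemma fPoly_hasLead (k : Type*) [Field k] (q m : ℕ) (hq : 1 ≤ q) (hm : 1 ≤ m) :
    HasLead k (- fPoly k q m) 0 (2 * (q + m) + 1) := by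
  have h1 := X0_mul_mem k (mono_mem_lowSpan k (e := 0 + (2 * (q + m) + 1)) (a := 3) (b := q + m - 1)
    (by omega)) (q - 1) m
  have h2 := C_mul_mem k (X0_mul_mem k (mono_mem_lowSpan k (e := 0 + (2 * (q + m) + 1)) (a := 1)
    (b := q + m) (by omega)) q m) 3
  have h3 := X0_mul_mem k (mono_mem_lowSpan k (e := 0 + (2 * (q + m) + 1)) (a := 0) (b := 0)
    (by omega)) (2 * q + 1) (2 * m)
  have h := Submodule.add_mem _ (Submodule.sub_mem _ h1 h2) h3
  rw [HasLead, fPoly]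
  convert h using 1
  rw [show (C 3 : MvPolynomial (Fin 4) k) = 3 from map_ofNat C 3]
  ring

lemma gPoly_mem (k : Type*) [Field k] (q m : ℕ) : gPoly k ∈ curveIdeal k q m := by
  rw [curveIdeal, RingHom.mem_ker]
  simp [gPoly, curveMap]
  ring

lemma pTwo_mem (k : Type*) [Field k] (q m : ℕ) : pTwo k q m ∈ curveIdeal k q m := by
  rw [curveIdeal, RingHom.mem_ker]
  simp [pTwo, curveMap]
  ring

lemma pThree_mem (k : Type*) [Field k] (q m : ℕ) : pThree k q m ∈ curveIdeal k q m := by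
  rw [curveIdeal, RingHom.mem_ker]
  simp [pThree, curveMap]
  ring

lemma X0_not_mem (k : Type*) [Field k] (q m : ℕ) : X 0 ∉ curveIdeal k q m := by
  rw [curveIdeal, RingHom.mem_ker]
  simp [curveMap]

lemma symbPow_of_mem (k : Type*) [Field k] (q m : ℕ) {w : MvPolynomial (Fin 4) k}
    (hw : w ∈ curveIdeal k q m) : w ∈ symbPow k q m 1 := by
  rw [mem_symbPow_iff]
  refine ⟨1, (Ideal.ne_top_iff_one _).mp Ideal.IsPrime.ne_top', ?_⟩
  simpa using hw

lemma symbPow_mul_mem (k : Type*) [Field k] (q m : ℕ) {i j : ℕ} {w z : MvPolynomial (Fin 4) k}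
    (hw : w ∈ symbPow k q m i) (hz : z ∈ symbPow k q m j) : w * z ∈ symbPow k q m (i + j) := by
  rw [mem_symbPow_iff] at *
  obtain ⟨s, hs, hsw⟩ := hw
  obtain ⟨t, ht, htz⟩ := hz
  refine ⟨s * t, ?_, ?_⟩
  · intro h
    rcases Ideal.IsPrime.mem_or_mem inferInstance h with h | h
    · exact hs h
    · exact ht h
  · rw [pow_add, mul_mul_mul_comm]
    exact Ideal.mul_mem_mul hsw htz

lemma symbPow_pow_mem (k : Type*) [Field k] (q m : ℕ) {i : ℕ} {w : MvPolynomial (Fin 4) k}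
    (hw : w ∈ symbPow k q m i) (l : ℕ) : w ^ l ∈ symbPow k q m (i * l) := by
  induction l with
  | zero =>
    rw [mem_symbPow_iff]
    exact ⟨1, (Ideal.ne_top_iff_one _).mp Ideal.IsPrime.ne_top', by simp⟩
  | succ l ih => exact pow_succ w l ▸ symbPow_mul_mem k q m ih hw

lemma fPoly_mem (k : Type*) [Field k] (q m : ℕ) (hq : 1 ≤ q) :
    - fPoly k q m ∈ symbPow k q m 2 := by
  rw [mem_symbPow_iff]
  refine ⟨X 0, X0_not_mem k q m, ?_⟩
  obtain ⟨q, rfl⟩ : ∃ q', q = q' + 1 := ⟨q - 1, by omega⟩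
  have h : X 0 * - fPoly k (q + 1) m = pTwo k (q + 1) m * pTwo k (q + 1) m -
      X 2 ^ (q + m) * (gPoly k * pThree k (q + 1) m) := by
    rw [fPoly, pTwo, pThree, gPoly, show q + 1 - 1 = q by omega, show q + 1 + m - 1 = q + m by omega]
    ring
  rw [h, sq]
  exact Ideal.sub_mem _ (Ideal.mul_mem_mul (pTwo_mem k _ m) (pTwo_mem k _ m))
    (Ideal.mul_mem_left _ _ (Ideal.mul_mem_mul (gPoly_mem k _ m) (pThree_mem k _ m)))

/-- Elements of the symbolic power with prescribed leading monomial. -/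
lemma exists_symbPow_hasLead (k : Type*) [Field k] (q m n : ℕ) (hq : 1 ≤ q) (hm : 1 ≤ m)
    (j ε b : ℕ) (hε : ε < 2) (h : (2*q+1+2*m) * (n - j) ≤ 2 * b + ε) :
    ∃ w ∈ symbPow k q m n, HasLead k w (2 * j + ε) b := by
  have hg := symbPow_of_mem k q m (gPoly_mem k q m)
  have hf := fPoly_mem k q m hq
  by_cases hj : n ≤ j
  · refine ⟨gPoly k ^ n * (X 1 ^ (2 * (j - n) + ε) * X 2 ^ b),
      Ideal.mul_mem_right _ _ (by simpa using symbPow_pow_mem k q m hg n), ?_⟩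
    have := ((gPoly_hasLead k).pow n).mul (HasLead.mono k (2 * (j - n) + ε) b)
    convert this using 1 <;> omega
  · obtain ⟨r, rfl⟩ : ∃ r, n = j + r := ⟨n - j, by omega⟩
    rw [Nat.add_sub_cancel_left] at h
    suffices H : ∃ w ∈ symbPow k q m r, HasLead k w ε b by
      obtain ⟨w, hw, hl⟩ := H
      refine ⟨gPoly k ^ j * w,
        symbPow_mul_mem k q m (by simpa using symbPow_pow_mem k q m hg j) hw, ?_⟩
      have := ((gPoly_hasLead k).pow j).mul hl
      convert this using 1; omega
    rcases Nat.even_or_odd' r with ⟨l, rfl | rfl⟩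
    · obtain ⟨b', rfl⟩ : ∃ b', b = (2 * (q + m) + 1) * l + b' := by
        refine ⟨b - (2 * (q + m) + 1) * l, ?_⟩
        have : (2*q+1+2*m) * (2 * l) = 2 * ((2 * (q + m) + 1) * l) := by ring
        omega
      refine ⟨(- fPoly k q m) ^ l * (X 1 ^ ε * X 2 ^ b'),
        Ideal.mul_mem_right _ _ (symbPow_pow_mem k q m hf l), ?_⟩
      have := ((fPoly_hasLead k q m hq hm).pow l).mul (HasLead.mono k ε b')
      convert this using 1; omega
    · have e : (2*q+1+2*m) * (2 * l + 1) = 2 * ((2 * (q + m) + 1) * l) + (2 * (q + m) + 1) := by ring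
      rw [e] at h
      obtain rfl | rfl : ε = 0 ∨ ε = 1 := by omega
      · obtain ⟨b', rfl⟩ : ∃ b', b = (2 * (q + m) + 1) * l + (q + m + 1) + b' :=
          ⟨b - ((2 * (q + m) + 1) * l + (q + m + 1)), by omega⟩
        refine ⟨(- fPoly k q m) ^ l * pThree k q m * (X 1 ^ 0 * X 2 ^ b'),
          Ideal.mul_mem_right _ _ (symbPow_mul_mem k q m (symbPow_pow_mem k q m hf l)
            (symbPow_of_mem k q m (pThree_mem k q m))), ?_⟩
        have := (((fPoly_hasLead k q m hq hm).pow l).mul (pThree_hasLead k q m hq)).mul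
          (HasLead.mono k 0 b')
        convert this using 1; omega
      · obtain ⟨b', rfl⟩ : ∃ b', b = (2 * (q + m) + 1) * l + (q + m) + b' :=
          ⟨b - ((2 * (q + m) + 1) * l + (q + m)), by omega⟩
        refine ⟨(- fPoly k q m) ^ l * pTwo k q m * (X 1 ^ 0 * X 2 ^ b'),
          Ideal.mul_mem_right _ _ (symbPow_mul_mem k q m (symbPow_pow_mem k q m hf l)
            (symbPow_of_mem k q m (pTwo_mem k q m))), ?_⟩
        have := (((fPoly_hasLead k q m hq hm).pow l).mul (pTwo_hasLead k q m)).mul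
          (HasLead.mono k 0 b')
        convert this using 1; omega

lemma basisElt_hasLead (k : Type*) [Field k] (j s : ℕ) :
    HasLead k (basisElt k j s) (2 * j + s % 2) (s / 2) := by
  have := ((gPoly_hasLead k).pow j).mul (HasLead.mono k (s % 2) (s / 2))
  rw [basisElt]
  convert this using 1; omega

lemma exists_mem_lowSpan (k : Type*) [Field k] (w : MvPolynomial (Fin 4) k) :
    ∃ e, w ∈ lowSpan k e := by
  induction w using MvPolynomial.induction_on with
  | C a =>
    refine ⟨1, ?_⟩
    have := C_mul_mem k (mono_mem_lowSpan k (e := 1) (a := 0) (b := 0) (by norm_num)) a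
    simpa using this
  | add p q hp hq =>
    obtain ⟨e, he⟩ := hp
    obtain ⟨e', he'⟩ := hq
    exact ⟨e + e', Submodule.add_mem _ (lowSpan_mono k (by omega) he)
      (lowSpan_mono k (by omega) he')⟩
  | mul_X p i hp =>
    obtain ⟨e, he⟩ := hp
    fin_cases i
    · exact ⟨e, by simpa [mul_comm] using X0_mul_mem k he 1 0⟩
    · refine ⟨e + 1, lowSpan_mul k he ?_⟩
      simpa using mono_mem_lowSpan k (e := 1 + 1) (a := 1) (b := 0) (by norm_num)
    · refine ⟨e + 1, lowSpan_mul k he ?_⟩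
      simpa using mono_mem_lowSpan k (e := 1 + 1) (a := 0) (b := 1) (by norm_num)
    · exact ⟨e, by simpa [mul_comm] using X0_mul_mem k he 0 1⟩

/-- The index set of the basis. -/
def basisIndex (q m n : ℕ) : Finset (Σ _ : ℕ, ℕ) :=
  (Finset.range n).sigma fun j => Finset.range ((2*q+1+2*m) * (n - j))

lemma span_basisElt (k : Type*) [Field k] (q m n : ℕ) (hq : 1 ≤ q) (hm : 1 ≤ m)
    (S : Submodule (MvPolynomial (Fin 2) k) (MvPolynomial (Fin 4) k))
    (hS1 : ∀ w ∈ symbPow k q m n, w ∈ S)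
    (hS2 : ∀ x ∈ basisIndex q m n, basisElt k x.1 x.2 ∈ S) (w : MvPolynomial (Fin 4) k) :
    w ∈ S := by
  have hlow : ∀ e, lowSpan k e ≤ S := by
    intro e
    induction e with
    | zero =>
      refine Submodule.span_le.mpr ?_
      rintro w ⟨a, b, hab, -⟩
      omega
    | succ e ih =>
      refine Submodule.span_le.mpr ?_
      rintro w ⟨a, b, hab, rfl⟩
      obtain ⟨z, hz, hl⟩ : ∃ z ∈ S, HasLead k z a b := by
        by_cases hc : 2 * b + a % 2 < (2*q+1+2*m) * (n - a / 2)
        · refine ⟨basisElt k (a / 2) (2 * b + a % 2), ?_, ?_⟩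
          · refine hS2 ⟨a / 2, 2 * b + a % 2⟩ ?_
            rw [basisIndex, Finset.mem_sigma, Finset.mem_range, Finset.mem_range]
            refine ⟨?_, hc⟩
            by_contra hn
            have hn2 : n ≤ a / 2 := not_lt.mp hn
            rw [show n - a / 2 = 0 by omega] at hc
            simp at hc
          · have := basisElt_hasLead k (a / 2) (2 * b + a % 2)
            convert this using 1 <;> omega
        · obtain ⟨z, hz, hl⟩ := exists_symbPow_hasLead k q m n hq hm (a / 2) (a % 2) b
            (Nat.mod_lt _ (by norm_num)) (not_lt.mp hc)
          refine ⟨z, hS1 z hz, ?_⟩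
          convert hl using 1; omega
      have h1 := ih (lowSpan_mono k (by omega) hl)
      have := S.sub_mem hz h1
      simpa using this
  obtain ⟨e, he⟩ := exists_mem_lowSpan k w
  exact hlow e he

lemma symbPow_ne_top (k : Type*) [Field k] (q m n : ℕ) (hn : 1 ≤ n) : symbPow k q m n ≠ ⊤ := by
  rw [Ideal.ne_top_iff_one, mem_symbPow_iff]
  rintro ⟨s, hs, h⟩
  rw [mul_one] at h
  exact hs (Ideal.pow_le_self (by omega) h)

/-- The basis of `R ⧸ symbPow` over `A`. -/
lemma exists_basis (k : Type*) [Field k] (q m n : ℕ) (hq : 1 ≤ q) (hm : 1 ≤ m)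
    (hco : Nat.Coprime (2*q+1) m) :
    Nonempty (Module.Basis (basisIndex q m n) (MvPolynomial (Fin 2) k)
      (MvPolynomial (Fin 4) k ⧸ symbPow k q m n)) := by
  let π := (Ideal.Quotient.mkₐ (MvPolynomial (Fin 2) k) (symbPow k q m n)).toLinearMap
  let v : (Σ _ : ℕ, ℕ) → MvPolynomial (Fin 4) k ⧸ symbPow k q m n :=
    fun x => π (basisElt k x.1 x.2)
  have hli : LinearIndepOn (MvPolynomial (Fin 2) k) v (basisIndex q m n) := by
    rw [linearIndepOn_finset_iff]
    intro f hf x hx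
    rw [basisIndex, Finset.sum_sigma] at hf
    have h1 : π (∑ j ∈ Finset.range n, ∑ s ∈ Finset.range ((2*q+1+2*m) * (n - j)),
        f ⟨j, s⟩ • basisElt k j s) = 0 := by
      simpa [v, map_sum, map_smul] using hf
    have h2 : (∑ j ∈ Finset.range n, ∑ s ∈ Finset.range ((2*q+1+2*m) * (n - j)),
        f ⟨j, s⟩ • basisElt k j s) ∈ symbPow k q m n := Ideal.Quotient.eq_zero_iff_mem.mp h1
    have h3 := basisElt_indep k q m n (fun j s => f ⟨j, s⟩) (theta_mem_of_symbPow k q m hco n _ h2)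
    rw [basisIndex, Finset.mem_sigma, Finset.mem_range, Finset.mem_range] at hx
    exact h3 x.1 hx.1 x.2 hx.2
  refine ⟨Module.Basis.mk (v := fun x : basisIndex q m n => v x) hli ?_⟩
  intro z _
  obtain ⟨w, rfl⟩ := Ideal.Quotient.mk_surjective z
  refine span_basisElt k q m n hq hm
    ((Submodule.span (MvPolynomial (Fin 2) k)
      (Set.range (fun x : basisIndex q m n => v x))).comap π) ?_ ?_ w
  · intro w hw
    rw [Submodule.mem_comap]
    have : π w = 0 := Ideal.Quotient.eq_zero_iff_mem.mpr hw
    rw [this]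
    exact Submodule.zero_mem _
  · intro x hx
    exact Submodule.subset_span ⟨⟨x, hx⟩, rfl⟩

/-- For all `n ≥ 1`, the sequence `x₁, x₄` is a regular sequence on
`R/𝔭⁽ⁿ⁾`; in particular `R/𝔭⁽ⁿ⁾` is Cohen–Macaulay (here expressed as: its Krull
dimension is `2`, matching the length of the regular sequence `x₁, x₄`). -/
theorem statement12 (k : Type*) [Field k] (q m : ℕ) (hq : 1 ≤ q) (hm : 1 ≤ m)
    (hco : Nat.Coprime (2*q+1) m) :
    ∀ n : ℕ, 1 ≤ n →
      RingTheory.Sequence.IsRegular (MvPolynomial (Fin 4) k ⧸ symbPow k q m n)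
        [(X 0 : MvPolynomial (Fin 4) k), X 3] ∧
      ringKrullDim (MvPolynomial (Fin 4) k ⧸ symbPow k q m n) = 2 := by
  intro n hn
  obtain ⟨B⟩ := exists_basis k q m n hq hm hco
  have hfree : Module.Free (MvPolynomial (Fin 2) k)
    (MvPolynomial (Fin 4) k ⧸ symbPow k q m n) := Module.Free.of_basis B
  have hfin : Module.Finite (MvPolynomial (Fin 2) k)
    (MvPolynomial (Fin 4) k ⧸ symbPow k q m n) := Module.Finite.of_basis B
  have hnt : Nontrivial (MvPolynomial (Fin 4) k ⧸ symbPow k q m n) :=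
    Ideal.Quotient.nontrivial_iff.mpr (symbPow_ne_top k q m n hn)
  constructor
  · have h1 := (isRegular_X_two k).of_faithfullyFlat
      (S := MvPolynomial (Fin 4) k ⧸ symbPow k q m n)
    refine ((AddEquiv.refl _).isRegular_congr ?_).mp h1
    have e0 : baseMap k (X 0) = X 0 := by simp [baseMap]
    have e1 : baseMap k (X 1) = X 3 := by simp [baseMap]
    have key : ∀ a : MvPolynomial (Fin 2) k, ∀ x : MvPolynomial (Fin 4) k ⧸ symbPow k q m n,
        algebraMap (MvPolynomial (Fin 2) k) (MvPolynomial (Fin 4) k ⧸ symbPow k q m n) a • x =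
          baseMap k a • x := by
      intro a x
      obtain ⟨y, rfl⟩ := Ideal.Quotient.mk_surjective x
      rfl
    refine List.Forall₂.cons ?_ (List.Forall₂.cons ?_ List.Forall₂.nil)
    · intro x
      have := key (X 0) x
      rw [e0] at this
      exact this
    · intro x
      have := key (X 1) x
      rw [e1] at this
      exact this
  · rw [ringKrullDim_eq_of_finite_faithfullyFlat (MvPolynomial (Fin 2) k),
      MvPolynomial.ringKrullDim_of_isNoetherianRing, ringKrullDim_eq_zero_of_field]
    simp
end

section
/- For every r ≥ 1 and every n ≥ 2r-1, the containment 𝔭^{(n)} ⊆ 𝔭^{r} holds. -/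
open MvPolynomial

namespace CurveAux

/-- Kernel of a monomial map. -/
theorem toric {σ τ k : Type*} [Field k] (θ : MvPolynomial σ k →ₗ[k] MvPolynomial τ k)
    (L : (σ →₀ ℕ) → (τ →₀ ℕ)) (hL : ∀ u, θ (monomial u 1) = monomial (L u) 1)
    (I : Ideal (MvPolynomial σ k))
    (hI : ∀ u v, L u = L v → (monomial u 1 - monomial v 1 : MvPolynomial σ k) ∈ I)
    (h : MvPolynomial σ k) (hh : θ h = 0) : h ∈ I := by
  let S : MvPolynomial τ k →ₗ[k] (MvPolynomial σ k ⧸ I) :=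
    (basisMonomials τ k).constr k (fun w => Ideal.Quotient.mk I (monomial (Function.invFun L w) 1))
  have hS : S.comp θ = (Ideal.Quotient.mkₐ k I).toLinearMap := by
    apply (basisMonomials σ k).ext
    intro u
    simp only [coe_basisMonomials, LinearMap.comp_apply, hL]
    have : S (monomial (L u) 1) = Ideal.Quotient.mk I (monomial (Function.invFun L (L u)) 1) := by
      have := (basisMonomials τ k).constr_basis k
        (fun w => Ideal.Quotient.mk I (monomial (Function.invFun L w) 1)) (L u)
      simpa only [coe_basisMonomials] using this
    rw [this]
    change _ = Ideal.Quotient.mk I (monomial u 1)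
    rw [Ideal.Quotient.eq]
    exact hI _ _ (Function.invFun_eq ⟨u, rfl⟩)
  have := congrArg (fun T => T h) hS
  simp only [LinearMap.comp_apply, hh, map_zero] at this
  exact Ideal.Quotient.eq_zero_iff_mem.mp this.symm

theorem mono2 {k : Type*} [Field k] (u : Fin 2 →₀ ℕ) :
    (monomial u 1 : MvPolynomial (Fin 2) k) = X 0 ^ u 0 * X 1 ^ u 1 := by
  rw [monomial_eq, Finsupp.prod_fintype _ _ (by simp)]; simp [Fin.prod_univ_succ]

theorem mono3 {k : Type*} [Field k] (u : Fin 3 →₀ ℕ) :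
    (monomial u 1 : MvPolynomial (Fin 3) k) = X 0 ^ u 0 * X 1 ^ u 1 * X 2 ^ u 2 := by
  rw [monomial_eq, Finsupp.prod_fintype _ _ (by simp)]; simp [Fin.prod_univ_succ, mul_assoc]

theorem mono4 {k : Type*} [Field k] (u : Fin 4 →₀ ℕ) :
    (monomial u 1 : MvPolynomial (Fin 4) k)
      = X 0 ^ u 0 * X 1 ^ u 1 * X 2 ^ u 2 * X 3 ^ u 3 := by
  rw [monomial_eq, Finsupp.prod_fintype _ _ (by simp)]; simp [Fin.prod_univ_succ, mul_assoc]

variable (k : Type*) [Field k] (q m : ℕ)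

noncomputable def psi : MvPolynomial (Fin 4) k →ₐ[k] MvPolynomial (Fin 3) k :=
  aeval ![X 0 ^ 2, X 0 * X 1, X 1 ^ 2, X 2]

noncomputable def phi' : MvPolynomial (Fin 3) k →ₐ[k] MvPolynomial (Fin 2) k :=
  aeval ![X 0 ^ (2*q+1+2*m), X 0 ^ (2*q+1) * X 1 ^ m, X 1 ^ (2*q+1+2*m)]

noncomputable def sq : MvPolynomial (Fin 2) k →ₐ[k] MvPolynomial (Fin 2) k :=
  aeval ![X 0 ^ 2, X 1]

noncomputable def g : MvPolynomial (Fin 3) k :=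
  X 0 ^ (2*q+1) * X 2 ^ m - X 1 ^ (2*q+1+2*m)

noncomputable def F1 : MvPolynomial (Fin 4) k := X 0 * X 2 - X 1 ^ 2

noncomputable def F2 : MvPolynomial (Fin 4) k := X 0 ^ (q+1) * X 3 ^ m - X 1 * X 2 ^ (q+m)

theorem comp_eq : (phi' k q m).comp (psi k) = (sq k).comp (curveMap k q m) := by
  apply algHom_ext
  intro i
  fin_cases i <;> simp [phi', psi, sq, curveMap] <;> ring

theorem sq_inj (h : MvPolynomial (Fin 2) k) (hh : sq k h = 0) : h = 0 := by
  have := toric (sq k).toLinearMap (fun u => Finsupp.equivFunOnFinite.symm ![2 * u 0, u 1]) ?_ ⊥ ?_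
    h hh
  · simpa using this
  · intro u
    simp [mono2, sq, pow_mul]
  · intro u v huv
    have h0 := DFunLike.congr_fun huv 0
    have h1 := DFunLike.congr_fun huv 1
    simp at h0 h1
    simp [mono2, h0, h1]

theorem ker_psi (h : MvPolynomial (Fin 4) k) (hh : psi k h = 0) : F1 k ∣ h := by
  rw [← Ideal.mem_span_singleton]
  refine toric (psi k).toLinearMap
    (fun u => Finsupp.equivFunOnFinite.symm ![2 * u 0 + u 1, u 1 + 2 * u 2, u 3]) ?_ _ ?_ h hh
  · intro u
    simp [mono3, mono4, psi]
    ring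
  · have key : ∀ u v : Fin 4 →₀ ℕ, u 1 ≤ v 1 → 2 * u 0 + u 1 = 2 * v 0 + v 1 →
        u 1 + 2 * u 2 = v 1 + 2 * v 2 → u 3 = v 3 →
        F1 k ∣ (monomial u 1 - monomial v 1 : MvPolynomial (Fin 4) k) := by
      intro u v h1 h2 h3 h4
      obtain ⟨l, hl⟩ : ∃ l, v 1 = u 1 + 2 * l := ⟨(v 1 - u 1) / 2, by omega⟩
      have e0 : u 0 = v 0 + l := by omega
      have e2 : u 2 = v 2 + l := by omega
      rw [mono4, mono4, hl, e0, e2, h4]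
      have : (X 0 ^ (v 0 + l) * X 1 ^ u 1 * X 2 ^ (v 2 + l) * X 3 ^ v 3 -
          X 0 ^ v 0 * X 1 ^ (u 1 + 2 * l) * X 2 ^ v 2 * X 3 ^ v 3 : MvPolynomial (Fin 4) k) =
          ((X 0 * X 2) ^ l - (X 1 ^ 2) ^ l) * (X 0 ^ v 0 * X 1 ^ u 1 * X 2 ^ v 2 * X 3 ^ v 3) := by
        ring
      rw [this]
      exact Dvd.dvd.mul_right (sub_dvd_pow_sub_pow _ _ _) _
    intro u v huv
    have h0 := DFunLike.congr_fun huv 0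
    have h1 := DFunLike.congr_fun huv 1
    have h2 := DFunLike.congr_fun huv 2
    simp at h0 h1 h2
    rw [Ideal.mem_span_singleton]
    rcases le_total (u 1) (v 1) with hle | hle
    · exact key u v hle h0 h1 h2
    · rw [← neg_sub, dvd_neg]
      exact key v u hle h0.symm h1.symm h2.symm

theorem ker_phi' (hco : Nat.Coprime (2*q+1) m) (h : MvPolynomial (Fin 3) k)
    (hh : phi' k q m h = 0) : g k q m ∣ h := by
  rw [← Ideal.mem_span_singleton]
  refine toric (phi' k q m).toLinearMap
    (fun u => Finsupp.equivFunOnFinite.symm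
      ![(2*q+1+2*m) * u 0 + (2*q+1) * u 1, m * u 1 + (2*q+1+2*m) * u 2]) ?_ _ ?_ h hh
  · intro u
    simp [mono2, mono3, phi']
    ring
  · have key : ∀ u v : Fin 3 →₀ ℕ, u 1 ≤ v 1 →
        (2*q+1+2*m) * u 0 + (2*q+1) * u 1 = (2*q+1+2*m) * v 0 + (2*q+1) * v 1 →
        m * u 1 + (2*q+1+2*m) * u 2 = m * v 1 + (2*q+1+2*m) * v 2 →
        g k q m ∣ (monomial u 1 - monomial v 1 : MvPolynomial (Fin 3) k) := by
      intro u v h1 h2 h3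
      obtain ⟨w, hw⟩ := Nat.exists_eq_add_of_le h1
      have hd : (2*q+1+2*m) ∣ m * w := by
        refine (Nat.dvd_add_right (Dvd.intro (v 2) rfl : (2*q+1+2*m) ∣ (2*q+1+2*m) * v 2)).mp ?_
        exact ⟨u 2, by rw [hw] at h3; linarith⟩
      have hc : Nat.Coprime (2*q+1+2*m) m := by
        simpa using hco
      obtain ⟨l, rfl⟩ := hc.dvd_of_dvd_mul_left hd
      have hpos : 0 < 2*q+1+2*m := by omega
      have e0 : u 0 = v 0 + (2*q+1) * l := by
        apply Nat.eq_of_mul_eq_mul_left hpos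
        rw [hw] at h2
        linarith
      have e2 : u 2 = v 2 + m * l := by
        apply Nat.eq_of_mul_eq_mul_left hpos
        rw [hw] at h3
        linarith
      rw [mono3, mono3, hw, e0, e2]
      have : (X 0 ^ (v 0 + (2*q+1) * l) * X 1 ^ u 1 * X 2 ^ (v 2 + m * l) -
          X 0 ^ v 0 * X 1 ^ (u 1 + (2*q+1+2*m) * l) * X 2 ^ v 2 : MvPolynomial (Fin 3) k) =
          ((X 0 ^ (2*q+1) * X 2 ^ m) ^ l - (X 1 ^ (2*q+1+2*m)) ^ l) *
            (X 0 ^ v 0 * X 1 ^ u 1 * X 2 ^ v 2) := by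
        simp only [mul_pow, ← pow_mul, pow_add]
        ring
      rw [this]
      exact Dvd.dvd.mul_right (sub_dvd_pow_sub_pow _ _ _) _
    intro u v huv
    have h0 := DFunLike.congr_fun huv 0
    have h1 := DFunLike.congr_fun huv 1
    simp at h0 h1
    rw [Ideal.mem_span_singleton]
    rcases le_total (u 1) (v 1) with hle | hle
    · exact key u v hle h0 h1
    · rw [← neg_sub, dvd_neg]
      exact key v u hle h0.symm h1.symm

theorem phi'_g : phi' k q m (g k q m) = 0 := by
  simp [phi', g]
  ring

/-- parity weight -/
def wt : Fin 3 → ZMod 2 := ![1, 1, 0]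

theorem even_psi (x : MvPolynomial (Fin 4) k) : IsWeightedHomogeneous wt (psi k x) 0 := by
  induction x using MvPolynomial.induction_on with
  | C a => simpa [psi] using isWeightedHomogeneous_C wt a
  | add p r hp hr => rw [map_add]; exact hp.add hr
  | mul_X p i hp =>
    rw [map_mul]
    have : IsWeightedHomogeneous wt (psi k (X i)) 0 := by
      have a0 := isWeightedHomogeneous_X k wt 0
      have a1 := isWeightedHomogeneous_X k wt 1
      have a2 := isWeightedHomogeneous_X k wt 2
      fin_cases i
      · have := a0.pow 2
        rw [show 2 • wt 0 = 0 from by decide] at this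
        simpa [psi] using this
      · have := a0.mul a1
        rw [show wt 0 + wt 1 = 0 from by decide] at this
        simpa [psi] using this
      · have := a1.pow 2
        rw [show 2 • wt 1 = 0 from by decide] at this
        simpa [psi] using this
      · simpa [psi, wt] using a2
    simpa using hp.mul this

theorem psi_of_even (w : MvPolynomial (Fin 3) k) (hw : IsWeightedHomogeneous wt w 0) :
    ∃ x, psi k x = w := by
  suffices w ∈ (psi k).range by simpa using this
  rw [as_sum w]
  refine Subalgebra.sum_mem _ fun u hu => ?_
  have h0 := hw (mem_support_iff.mp hu)
  have h1 : ((u 0 + u 1 : ℕ) : ZMod 2) = 0 := by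
    rw [Finsupp.weight_apply, Finsupp.sum_fintype _ _ (by simp)] at h0
    simpa [Fin.sum_univ_succ, wt] using h0
  rw [ZMod.natCast_eq_zero_iff] at h1
  have h2 : monomial u (coeff u w) = coeff u w • (monomial u 1 : MvPolynomial (Fin 3) k) := by
    simp [smul_monomial]
  rw [h2]
  refine Subalgebra.smul_mem _ ?_ _
  rw [mono3]
  refine ⟨X 0 ^ (u 0 / 2) * X 1 ^ (u 0 % 2) * X 2 ^ (u 1 / 2) * X 3 ^ (u 2), ?_⟩
  have e0 : u 0 = 2 * (u 0 / 2) + u 0 % 2 := by omega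
  have e1 : u 1 = 2 * (u 1 / 2) + u 0 % 2 := by omega
  rw [show (X 0 ^ u 0 * X 1 ^ u 1 * X 2 ^ u 2 : MvPolynomial (Fin 3) k) =
    X 0 ^ (2 * (u 0 / 2) + u 0 % 2) * X 1 ^ (2 * (u 1 / 2) + u 0 % 2) * X 2 ^ u 2 by
      rw [← e0, ← e1]]
  simp [psi]
  ring

theorem psi_div (x y : MvPolynomial (Fin 4) k) (w : MvPolynomial (Fin 3) k)
    (hx : psi k x ≠ 0) (h : psi k x * w = psi k y) : ∃ z, psi k z = w := by
  set w0 := weightedHomogeneousComponent wt 0 w with hw0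
  set w1 := weightedHomogeneousComponent wt 1 w with hw1
  have hsum : w = w0 + w1 := by
    ext d
    rw [coeff_add, hw0, hw1, coeff_weightedHomogeneousComponent, coeff_weightedHomogeneousComponent]
    have : ∀ z : ZMod 2, (z = 0 ∧ z ≠ 1) ∨ (z = 1 ∧ z ≠ 0) := by decide
    rcases this (Finsupp.weight wt d) with h | h <;> simp [h.1]
  have he0 : IsWeightedHomogeneous wt w0 0 := weightedHomogeneousComponent_isWeightedHomogeneous _ _
  have he1 : IsWeightedHomogeneous wt w1 1 := weightedHomogeneousComponent_isWeightedHomogeneous _ _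
  have p1 : IsWeightedHomogeneous wt (psi k x * w1) 1 := by
    simpa using (even_psi k x).mul he1
  have p0 : IsWeightedHomogeneous wt (psi k x * w1) 0 := by
    have e : psi k x * w1 = psi k y - psi k x * w0 := by rw [← h, hsum]; ring
    rw [e]
    exact (even_psi k y).sub (by simpa using (even_psi k x).mul he0)
  have hz : psi k x * w1 = 0 := by
    by_contra hne
    exact absurd (p0.inj_right hne p1) (by decide)
  have hw1z : w1 = 0 := (mul_eq_zero.mp hz).resolve_left hx
  apply psi_of_even
  rw [hsum, hw1z, add_zero]
  exact he0

theorem mem_p (h : MvPolynomial (Fin 4) k) :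
    h ∈ curveIdeal k q m ↔ phi' k q m (psi k h) = 0 := by
  have e : phi' k q m (psi k h) = sq k (curveMap k q m h) :=
    DFunLike.congr_fun (comp_eq k q m) h
  rw [e, curveIdeal, RingHom.mem_ker]
  exact ⟨fun h => by rw [h, map_zero], sq_inj k _⟩

theorem mem_p_iff (hco : Nat.Coprime (2*q+1) m) (h : MvPolynomial (Fin 4) k) :
    h ∈ curveIdeal k q m ↔ g k q m ∣ psi k h := by
  rw [mem_p]
  refine ⟨ker_phi' k q m hco _, ?_⟩
  rintro ⟨c, hc⟩
  rw [hc, map_mul, phi'_g, zero_mul]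

theorem psi_F1 : psi k (F1 k) = 0 := by
  simp [psi, F1]; ring

theorem psi_F2 : psi k (F2 k q m) = X 0 * g k q m := by
  simp [psi, F2, g]; ring

theorem psi_f (hq : 1 ≤ q) : psi k (fPoly k q m) = - g k q m ^ 2 := by
  obtain ⟨q, rfl⟩ := Nat.exists_eq_add_of_le' hq
  have : q + 1 + m - 1 = q + m := by omega
  have h3 : psi k 3 = 3 := map_ofNat (psi k) 3
  simp only [fPoly, map_add, map_sub, map_mul, map_neg, map_pow, h3, this]
  simp [psi, g]; ring

theorem g_ne : g k q m ≠ 0 := by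
  intro h
  have := congrArg (aeval (R := k) ![(0 : k), 1, 0]) h
  simp [g] at this

theorem F1_ne : F1 k ≠ 0 := by
  intro h
  have := congrArg (aeval (R := k) ![(0 : k), 1, 0, 0]) h
  simp [F1] at this

theorem F1_mem : F1 k ∈ curveIdeal k q m := by
  rw [mem_p, psi_F1, map_zero]

theorem F2_mem (hco : Nat.Coprime (2*q+1) m) : F2 k q m ∈ curveIdeal k q m := by
  rw [mem_p_iff k q m hco, psi_F2]; exact Dvd.intro_left _ rfl

theorem f_mem (hq : 1 ≤ q) (hco : Nat.Coprime (2*q+1) m) :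
    fPoly k q m ∈ curveIdeal k q m := by
  rw [mem_p_iff k q m hco, psi_f k q m hq, dvd_neg]; exact dvd_pow_self _ two_ne_zero

theorem X0_notMem : (X 0 : MvPolynomial (Fin 4) k) ∉ curveIdeal k q m := by
  rw [curveIdeal, RingHom.mem_ker]
  simp [curveMap]

theorem mem_symb (n : ℕ) (h : MvPolynomial (Fin 4) k) :
    h ∈ symbPow k q m n ↔ ∃ s ∉ curveIdeal k q m, s * h ∈ curveIdeal k q m ^ n := by
  rw [symbPow, Ideal.mem_comap,
    IsLocalization.algebraMap_mem_map_algebraMap_iff (curveIdeal k q m).primeCompl]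
  rfl

theorem g_pow_dvd (hco : Nat.Coprime (2*q+1) m) (n : ℕ) (h : MvPolynomial (Fin 4) k)
    (hh : h ∈ curveIdeal k q m ^ n) : g k q m ^ n ∣ psi k h := by
  have h1 : (curveIdeal k q m).map (psi k) ≤ Ideal.span {g k q m} := by
    rw [Ideal.map_le_iff_le_comap]
    intro x hx
    rw [Ideal.mem_comap, Ideal.mem_span_singleton]
    exact (mem_p_iff k q m hco x).mp hx
  have h2 := Ideal.pow_right_mono h1 n
  rw [← Ideal.map_pow, Ideal.span_singleton_pow] at h2
  exact Ideal.mem_span_singleton.mp (h2 (Ideal.mem_map_of_mem _ hh))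

theorem g_pow_dvd_of_mul (hco : Nat.Coprime (2*q+1) m) (u : MvPolynomial (Fin 3) k)
    (hu : phi' k q m u ≠ 0) (n : ℕ) (v : MvPolynomial (Fin 3) k)
    (h : g k q m ^ n ∣ u * v) : g k q m ^ n ∣ v := by
  induction n generalizing v with
  | zero => simp
  | succ n ih =>
    have h1 : phi' k q m v = 0 := by
      obtain ⟨c, hc⟩ := (dvd_pow_self _ n.succ_ne_zero).trans h
      have := congrArg (phi' k q m) hc
      rw [map_mul, map_mul, phi'_g, zero_mul] at this
      exact (mul_eq_zero.mp this).resolve_left hu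
    obtain ⟨v', rfl⟩ := ker_phi' k q m hco v h1
    rw [pow_succ'] at h ⊢
    apply mul_dvd_mul_left
    apply ih
    rw [mul_left_comm] at h
    exact (mul_dvd_mul_iff_left (g_ne k q m)).mp h

/-- Elements of the odd symbolic powers, modulo `F1`. -/
theorem symb_decomp (hq : 1 ≤ q) (hco : Nat.Coprime (2*q+1) m) (j : ℕ)
    (h : MvPolynomial (Fin 4) k) (hh : h ∈ symbPow k q m (2*j+1)) :
    ∃ h' ∈ curveIdeal k q m, ∃ b, h = fPoly k q m ^ j * h' + F1 k * b := by
  obtain ⟨s, hs, hsh⟩ := (mem_symb k q m _ h).mp hh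
  have h1 := g_pow_dvd k q m hco _ _ hsh
  rw [map_mul] at h1
  rw [mem_p] at hs
  obtain ⟨w, hw⟩ := g_pow_dvd_of_mul k q m hco _ hs _ _ h1
  have hf : psi k (fPoly k q m ^ j) = (-1) ^ j * g k q m ^ (2 * j) := by
    rw [map_pow, psi_f k q m hq, neg_pow, ← pow_mul]
  have hsgn : ((-1 : MvPolynomial (Fin 3) k) ^ j) * (-1) ^ j = 1 := by
    rw [← mul_pow]; simp
  have hE : psi k (fPoly k q m ^ j) * ((-1) ^ j * (g k q m * w)) = psi k h := by
    rw [hf, hw, pow_succ]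
    linear_combination (g k q m ^ (2*j) * g k q m * w) * hsgn
  obtain ⟨h', hh'⟩ := psi_div k _ _ _ (by
    rw [map_pow, psi_f k q m hq]
    exact pow_ne_zero _ (neg_ne_zero.mpr (pow_ne_zero _ (g_ne k q m)))) hE
  refine ⟨h', ?_, ?_⟩
  · rw [mem_p_iff k q m hco, hh']
    exact ⟨(-1) ^ j * w, by ring⟩
  · obtain ⟨b, hb⟩ := ker_psi k (h - fPoly k q m ^ j * h') (by
      rw [map_sub, map_mul, hh', hE, sub_self])
    exact ⟨b, by rw [← hb]; ring⟩

theorem X0_mul (hco : Nat.Coprime (2*q+1) m) (h : MvPolynomial (Fin 4) k)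
    (hh : h ∈ curveIdeal k q m) : X 0 * h ∈ Ideal.span {F1 k} ⊔ Ideal.span {F2 k q m} := by
  obtain ⟨w, hw⟩ := (mem_p_iff k q m hco h).mp hh
  have hE : psi k (F2 k q m) * (X 0 * w) = psi k (X 0 * h) := by
    rw [psi_F2, map_mul, hw]
    simp [psi]
    ring
  obtain ⟨z, hz⟩ := psi_div k _ _ _ (by
    rw [psi_F2]; exact mul_ne_zero (X_ne_zero _) (g_ne k q m)) hE
  obtain ⟨b, hb⟩ := ker_psi k (X 0 * h - F2 k q m * z) (by
      rw [map_sub, map_mul (psi k) (F2 k q m), hz, hE, sub_self])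
  have : X 0 * h = F1 k * b + F2 k q m * z := by rw [← hb]; ring
  rw [this]
  exact Submodule.add_mem_sup (Ideal.mul_mem_right _ _ (Ideal.mem_span_singleton_self _))
    (Ideal.mul_mem_right _ _ (Ideal.mem_span_singleton_self _))

theorem X0_pow_mul (hco : Nat.Coprime (2*q+1) m) (n : ℕ) (h : MvPolynomial (Fin 4) k)
    (hh : h ∈ curveIdeal k q m ^ n) :
    X 0 ^ n * h ∈ (Ideal.span {F1 k} ⊔ Ideal.span {F2 k q m}) ^ n := by
  have h1 : Ideal.span {X 0} * curveIdeal k q m ≤ Ideal.span {F1 k} ⊔ Ideal.span {F2 k q m} := by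
    rw [Ideal.span_singleton_mul_le_iff]
    exact fun z hz => X0_mul k q m hco z hz
  have h2 := Ideal.pow_right_mono h1 n
  rw [mul_pow, Ideal.span_singleton_pow] at h2
  exact h2 (Ideal.mul_mem_mul (Ideal.mem_span_singleton_self _) hh)

theorem pow_decomp {A : Type*} [CommRing A] (x y : A) (n : ℕ) (h : A)
    (hh : h ∈ (Ideal.span {x} ⊔ Ideal.span {y}) ^ (n+1)) :
    ∃ α ∈ (Ideal.span {x} ⊔ Ideal.span {y}) ^ n, ∃ c, h = x * α + y ^ (n+1) * c := by
  induction n generalizing h with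
  | zero =>
    rw [zero_add, pow_one, Submodule.mem_sup] at hh
    obtain ⟨a, ha, b, hb, rfl⟩ := hh
    obtain ⟨a, rfl⟩ := Ideal.mem_span_singleton.mp ha
    obtain ⟨b, rfl⟩ := Ideal.mem_span_singleton.mp hb
    exact ⟨a, by simp, b, by ring⟩
  | succ n ih =>
    rw [pow_succ' _ (n+1), Ideal.sup_mul, Submodule.mem_sup] at hh
    obtain ⟨a, ha, b, hb, rfl⟩ := hh
    obtain ⟨a, ha', rfl⟩ := Ideal.mem_span_singleton_mul.mp ha
    obtain ⟨b, hb', rfl⟩ := Ideal.mem_span_singleton_mul.mp hb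
    obtain ⟨α, hα, c, rfl⟩ := ih b hb'
    refine ⟨a + y * α, ?_, c, by ring⟩
    refine Ideal.add_mem _ ha' ?_
    rw [pow_succ']
    exact Ideal.mul_mem_mul (Submodule.mem_sup_right (Ideal.mem_span_singleton_self _)) hα

theorem symb_div (hco : Nat.Coprime (2*q+1) m) (n : ℕ) (b : MvPolynomial (Fin 4) k)
    (hb : F1 k * b ∈ symbPow k q m (n+1)) : b ∈ symbPow k q m n := by
  rw [mem_symb] at hb ⊢
  obtain ⟨s, hs, hsb⟩ := hb
  have hP : (curveIdeal k q m).IsPrime := inferInstance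
  refine ⟨X 0 ^ (n+1) * s, ?_, ?_⟩
  · intro hmem
    rcases hP.mem_or_mem hmem with h | h
    · exact X0_notMem k q m (hP.mem_of_pow_mem _ h)
    · exact hs h
  obtain ⟨α, hα, c, hc⟩ := pow_decomp _ _ _ _ (X0_pow_mul k q m hco _ _ hsb)
  have hle : Ideal.span {F1 k} ⊔ Ideal.span {F2 k q m} ≤ curveIdeal k q m := by
    rw [sup_le_iff, Ideal.span_singleton_le_iff_mem, Ideal.span_singleton_le_iff_mem]
    exact ⟨F1_mem k q m, F2_mem k q m hco⟩
  have hc0 : psi k c = 0 := by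
    have := congrArg (psi k) hc
    simp only [map_mul, map_add, map_pow, psi_F1, zero_mul, mul_zero, zero_add, psi_F2] at this
    exact (mul_eq_zero.mp this.symm).resolve_left
      (pow_ne_zero _ (mul_ne_zero (X_ne_zero _) (g_ne k q m)))
  obtain ⟨c', rfl⟩ := ker_psi k c hc0
  have : X 0 ^ (n+1) * s * b = α + F2 k q m ^ (n+1) * c' := by
    apply mul_left_cancel₀ (F1_ne k)
    linear_combination hc
  rw [this]
  refine Ideal.add_mem _ (Ideal.pow_right_mono hle n hα) (Ideal.mul_mem_right _ _ ?_)
  exact Ideal.pow_le_pow_right n.le_succ (Ideal.pow_mem_pow (F2_mem k q m hco) _)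

theorem symb_anti {a b : ℕ} (hab : a ≤ b) : symbPow k q m b ≤ symbPow k q m a := by
  intro h hh
  rw [mem_symb] at hh ⊢
  obtain ⟨s, hs, h1⟩ := hh
  exact ⟨s, hs, Ideal.pow_le_pow_right hab h1⟩

theorem F3_mem (hco : Nat.Coprime (2*q+1) m) :
    X 0 ^ q * X 1 * X 3 ^ m - X 2 ^ (q+m+1) ∈ curveIdeal k q m := by
  rw [mem_p_iff k q m hco]
  exact ⟨X 1, by simp [psi, g]; ring⟩

theorem X0_f (hq : 1 ≤ q) (hco : Nat.Coprime (2*q+1) m) :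
    X 0 * fPoly k q m ∈ curveIdeal k q m ^ 2 := by
  have : X 0 * fPoly k q m = -(F2 k q m * F2 k q m) + X 2 ^ (q+m-1) *
      (F1 k * (X 0 ^ q * X 1 * X 3 ^ m - X 2 ^ (q+m+1))) := by
    obtain ⟨q, rfl⟩ := Nat.exists_eq_add_of_le' hq
    have : q + 1 + m - 1 = q + m := by omega
    simp only [fPoly, F1, F2, this, Nat.add_sub_cancel]
    ring
  rw [this, pow_two]
  have h2 := F2_mem k q m hco
  exact Ideal.add_mem _ (neg_mem (Ideal.mul_mem_mul h2 h2))
    (Ideal.mul_mem_left _ _ (Ideal.mul_mem_mul (F1_mem k q m) (F3_mem k q m hco)))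

theorem f_symb (hq : 1 ≤ q) (hco : Nat.Coprime (2*q+1) m) (j : ℕ) (h : MvPolynomial (Fin 4) k)
    (hh : h ∈ curveIdeal k q m) :
    fPoly k q m ^ j * h ∈ symbPow k q m (2*j+1) := by
  rw [mem_symb]
  have hP : (curveIdeal k q m).IsPrime := inferInstance
  refine ⟨X 0 ^ j, fun h => X0_notMem k q m (hP.mem_of_pow_mem _ h), ?_⟩
  rw [← mul_assoc, ← mul_pow, pow_succ, pow_mul]
  exact Ideal.mul_mem_mul (Ideal.pow_mem_pow (X0_f k q m hq hco) _) hh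

theorem main (hq : 1 ≤ q) (hco : Nat.Coprime (2*q+1) m) (j : ℕ) :
    symbPow k q m (2*j+1) ≤ curveIdeal k q m ^ (j+1) := by
  induction j with
  | zero =>
    intro h hh
    obtain ⟨h', hh', b, rfl⟩ := symb_decomp k q m hq hco 0 h hh
    rw [zero_add, pow_one]
    exact Ideal.add_mem _ (Ideal.mul_mem_left _ _ hh') (Ideal.mul_mem_right _ _ (F1_mem k q m))
  | succ j ih =>
    intro h hh
    obtain ⟨h', hh', b, hb⟩ := symb_decomp k q m hq hco (j+1) h hh
    have hb1 : F1 k * b ∈ symbPow k q m (2*(j+1)+1) := by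
      have e : F1 k * b = h - fPoly k q m ^ (j+1) * h' := by rw [hb]; ring
      rw [e]
      exact Ideal.sub_mem _ hh (f_symb k q m hq hco _ _ hh')
    have hb2 := ih (symb_anti k q m (by omega) (symb_div k q m hco _ b hb1))
    rw [hb]
    refine Ideal.add_mem _ ?_ ?_
    · rw [pow_succ]
      exact Ideal.mul_mem_mul (Ideal.pow_mem_pow (f_mem k q m hq hco) _) hh'
    · rw [pow_succ']
      exact Ideal.mul_mem_mul (F1_mem k q m) hb2

end CurveAux

/-- For every `r ≥ 1` and every `n ≥ 2r-1`, `𝔭⁽ⁿ⁾ ⊆ 𝔭ʳ`. -/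
theorem statement15 (k : Type*) [Field k] (q m : ℕ) (hq : 1 ≤ q) (hm : 1 ≤ m)
    (hco : Nat.Coprime (2*q+1) m) :
    ∀ r : ℕ, 1 ≤ r → ∀ n : ℕ, 2*r - 1 ≤ n →
      symbPow k q m n ≤ (curveIdeal k q m) ^ r := by
  intro r hr n hn
  obtain ⟨j, rfl⟩ := Nat.exists_eq_add_of_le' hr
  exact (CurveAux.symb_anti k q m (by omega)).trans (CurveAux.main k q m hq hco j)
end

section
/- For all n ≥ 1, 𝔭^{(3n)} ⊆ 𝔪^{2n}·𝔭^{n}, where 𝔪 = (x₁,x₂,x₃,x₄); moreover the stronger containments 𝔭^{(2n)} ⊆ 𝔪^{n}·𝔭^{n} and 𝔭^{(2n+1)} ⊆ 𝔪^{n}·𝔭^{n} hold. -/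
open MvPolynomial

section Aux
variable {k : Type*} [Field k]

abbrev R4 (k : Type*) [Field k] := MvPolynomial (Fin 4) k
abbrev S2 (k : Type*) [Field k] := Polynomial (MvPolynomial (Fin 2) k)
abbrev T2 (k : Type*) [Field k] := Polynomial (S2 k)

/-- `g₁ = x₁x₃ - x₂²` -/
noncomputable def gA (k : Type*) [Field k] : R4 k := X 0 * X 2 - X 1 ^ 2
/-- `g₂` (with `q = p + 1`) -/
noncomputable def gB (k : Type*) [Field k] (p m : ℕ) : R4 k :=
  X 0 ^ (p+2) * X 3 ^ m - X 1 * X 2 ^ (p+m+1)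
/-- `g₃` -/
noncomputable def gC (k : Type*) [Field k] (p m : ℕ) : R4 k :=
  X 0 ^ (p+1) * X 1 * X 3 ^ m - X 2 ^ (p+m+2)
/-- the extra generator of the second symbolic power -/
noncomputable def gF (k : Type*) [Field k] (p m : ℕ) : R4 k :=
  - X 2 ^ (p+m+1) * gC k p m
    + X 0 ^ p * X 3 ^ m * (X 0 * gB k p m - X 1 * X 2 ^ (p+m) * gA k)

lemma rel1 (p m : ℕ) : X 0 * gC k p m = X 1 * gB k p m - X 2 ^ (p+m+1) * gA k := by
  simp only [gA, gB, gC]; ring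
lemma rel2 (p m : ℕ) : X 1 * gC k p m = X 2 * gB k p m - X 0 ^ (p+1) * X 3 ^ m * gA k := by
  simp only [gA, gB, gC]; ring
lemma rel3 (p m : ℕ) : X 0 * gF k p m = gB k p m ^ 2 - X 2 ^ (p+m) * gA k * gC k p m := by
  simp only [gA, gB, gC, gF]; ring
lemma rel4 (p m : ℕ) : X 1 * gF k p m =
    gB k p m * gC k p m + X 2 ^ (p+m) * X 0 ^ p * X 3 ^ m * gA k ^ 2 := by
  simp only [gA, gB, gC, gF]; ring

/-- the ideal generated by the three minors -/
noncomputable def P3 (k : Type*) [Field k] (p m : ℕ) : Ideal (R4 k) :=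
  Ideal.span {gA k, gB k p m, gC k p m}

lemma gA_mem (p m : ℕ) : gA k ∈ P3 k p m := Ideal.subset_span (by simp)
lemma gB_mem (p m : ℕ) : gB k p m ∈ P3 k p m := Ideal.subset_span (by simp)
lemma gC_mem (p m : ℕ) : gC k p m ∈ P3 k p m := Ideal.subset_span (by simp)

lemma mem_P3 {p m : ℕ} {x : R4 k} : x ∈ P3 k p m ↔
    ∃ a b c, x = a * gA k + b * gB k p m + c * gC k p m := by
  rw [P3, Ideal.mem_span_insert]
  constructor
  · rintro ⟨a, z, hz, rfl⟩
    obtain ⟨b, c, rfl⟩ := Ideal.mem_span_pair.1 hz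
    exact ⟨a, b, c, by ring⟩
  · rintro ⟨a, b, c, rfl⟩
    exact ⟨a, b * gB k p m + c * gC k p m, Ideal.mem_span_pair.2 ⟨b, c, rfl⟩, by ring⟩

/-- generic monomial -/
noncomputable def mon (k : Type*) [Field k] (i j l r : ℕ) : R4 k :=
  X 0 ^ i * X 1 ^ j * X 2 ^ l * X 3 ^ r

lemma reduce (p m : ℕ) : ∀ w i j l r : ℕ, 2 * j + 3 * l ≤ w →
    ∃ i' j' l' r', j' ≤ 1 ∧ j' + 2 * l' ≤ 2 * (p+m+1) ∧
      i + j + l + r = i' + j' + l' + r' ∧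
      m * (j + 2 * l) + (2*(p+m+1)+1) * r = m * (j' + 2 * l') + (2*(p+m+1)+1) * r' ∧
      mon k i j l r - mon k i' j' l' r' ∈ P3 k p m := by
  intro w
  induction w with
  | zero =>
    intro i j l r h
    exact ⟨i, j, l, r, by omega, by omega, rfl, rfl, by simp⟩
  | succ w ih =>
    intro i j l r h
    by_cases hj : 2 ≤ j
    · obtain ⟨j, rfl⟩ := Nat.exists_eq_add_of_le hj
      obtain ⟨i', j', l', r', h1, h2, h3, h4, h5⟩ := ih (i+1) j (l+1) r (by omega)
      refine ⟨i', j', l', r', h1, h2, by omega, by rw [← h4]; ring, ?_⟩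
      have : mon k i (2+j) l r - mon k i' j' l' r' =
        (mon k (i+1) j (l+1) r - mon k i' j' l' r') - mon k i j l r * gA k := by
        simp only [mon, gA]; ring
      rw [this]
      exact sub_mem h5 (Ideal.mul_mem_left _ _ (gA_mem p m))
    by_cases hl : p+m+2 ≤ l
    · obtain ⟨l, rfl⟩ := Nat.exists_eq_add_of_le hl
      obtain ⟨i', j', l', r', h1, h2, h3, h4, h5⟩ := ih (i+p+1) (j+1) l (r+m) (by omega)
      refine ⟨i', j', l', r', h1, h2, by omega, by rw [← h4]; ring, ?_⟩
      have : mon k i j (p+m+2+l) r - mon k i' j' l' r' =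
        (mon k (i+p+1) (j+1) l (r+m) - mon k i' j' l' r') - mon k i j l r * gC k p m := by
        simp only [mon, gC]; ring
      rw [this]
      exact sub_mem h5 (Ideal.mul_mem_left _ _ (gC_mem p m))
    by_cases hl2 : j = 1 ∧ l = p+m+1
    · obtain ⟨rfl, rfl⟩ := hl2
      obtain ⟨i', j', l', r', h1, h2, h3, h4, h5⟩ := ih (i+p+2) 0 0 (r+m) (by omega)
      refine ⟨i', j', l', r', h1, h2, by omega, by rw [← h4]; ring, ?_⟩
      have : mon k i 1 (p+m+1) r - mon k i' j' l' r' =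
        (mon k (i+p+2) 0 0 (r+m) - mon k i' j' l' r') - mon k i 0 0 r * gB k p m := by
        simp only [mon, gB]; ring
      rw [this]
      exact sub_mem h5 (Ideal.mul_mem_left _ _ (gB_mem p m))
    exact ⟨i, j, l, r, by omega, by omega, rfl, rfl, by simp⟩

lemma mon_congr (p m : ℕ) (hm : Nat.Coprime (2*(p+m+1)+1) m) (i j l r i' j' l' r' : ℕ)
    (h1 : i + j + l + r = i' + j' + l' + r')
    (h2 : m * (j + 2 * l) + (2*(p+m+1)+1) * r = m * (j' + 2 * l') + (2*(p+m+1)+1) * r') :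
    mon k i j l r - mon k i' j' l' r' ∈ P3 k p m := by
  obtain ⟨a, b, c, d, e1, e2, e3, e4, e5⟩ := reduce (k := k) p m _ i j l r le_rfl
  obtain ⟨a', b', c', d', f1, f2, f3, f4, f5⟩ := reduce (k := k) p m _ i' j' l' r' le_rfl
  have key : m * (b + 2 * c) + (2*(p+m+1)+1) * d = m * (b' + 2 * c') + (2*(p+m+1)+1) * d' := by
    omega
  have hmod : m * (b + 2 * c) ≡ m * (b' + 2 * c') [MOD (2*(p+m+1)+1)] := by
    have := congrArg (· % (2*(p+m+1)+1)) key
    simpa [Nat.ModEq, Nat.add_mul_mod_self_left] using this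
  have hmod2 := Nat.ModEq.cancel_left_of_coprime hm hmod
  have hb : b + 2 * c = b' + 2 * c' :=
    Nat.ModEq.eq_of_lt_of_lt hmod2 (by omega) (by omega)
  rw [hb] at key
  have hd : d = d' := Nat.eq_of_mul_eq_mul_left (by omega) (Nat.add_left_cancel key)
  obtain rfl : b = b' := by omega
  obtain rfl : c = c' := by omega
  subst hd
  obtain rfl : a = a' := by omega
  have := sub_mem e5 f5
  simpa using this

lemma monomial_eq_mon (e : Fin 4 →₀ ℕ) (c : k) :
    monomial e c = C c * mon k (e 0) (e 1) (e 2) (e 3) := by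
  rw [monomial_eq, Finsupp.prod_fintype _ _ (by simp)]
  simp [Fin.prod_univ_four, mon]

lemma curveMap_mon (p m i j l r : ℕ) : curveMap k (p+1) m (mon k i j l r) =
    monomial (Finsupp.single 0 ((2*(p+m+1)+1) * i + (2*(p+1)+1+m)*j + (2*(p+1)+1) * l) +
      Finsupp.single 1 (m * (j + 2 * l) + (2*(p+m+1)+1) * r)) 1 := by
  have : (monomial (Finsupp.single (0 : Fin 2) ((2*(p+m+1)+1) * i + (2*(p+1)+1+m)*j + (2*(p+1)+1) * l) +
      Finsupp.single 1 (m * (j + 2 * l) + (2*(p+m+1)+1) * r)) (1:k)) =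
      X 0 ^ ((2*(p+m+1)+1) * i + (2*(p+1)+1+m)*j + (2*(p+1)+1) * l) *
      X 1 ^ (m * (j + 2 * l) + (2*(p+m+1)+1) * r) := by
    rw [X_pow_eq_monomial, X_pow_eq_monomial, monomial_mul, one_mul]
  rw [this]
  simp only [mon, curveMap, map_mul, map_pow, aeval_X, Matrix.cons_val]
  ring

lemma ker_le (p m : ℕ) (hm : Nat.Coprime (2*(p+m+1)+1) m) :
    curveIdeal k (p+1) m ≤ P3 k p m := by
  classical
  let dg : (Fin 4 →₀ ℕ) → (Fin 2 →₀ ℕ) := fun e =>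
    Finsupp.single 0 ((2*(p+m+1)+1) * e 0 + (2*(p+1)+1+m)* e 1 + (2*(p+1)+1) * e 2) +
      Finsupp.single 1 (m * (e 1 + 2 * e 2) + (2*(p+m+1)+1) * e 3)
  let σ : (Fin 2 →₀ ℕ) → (Fin 4 →₀ ℕ) := Function.invFun dg
  have hσ : ∀ e, dg (σ (dg e)) = dg e := fun e => Function.invFun_eq ⟨e, rfl⟩
  let Θ : MvPolynomial (Fin 2) k →ₗ[k] R4 k :=
    (MvPolynomial.basisMonomials (Fin 2) k).constr k (fun δ => monomial (σ δ) 1)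
  have hΘ : ∀ δ, Θ (monomial δ 1) = monomial (σ δ) 1 := by
    intro δ
    have := (MvPolynomial.basisMonomials (Fin 2) k).constr_basis k
      (fun δ => (monomial (σ δ) 1 : R4 k)) δ
    simpa using this
  have main : ∀ h : R4 k, h - Θ (curveMap k (p+1) m h) ∈ P3 k p m := by
    intro h
    induction h using MvPolynomial.induction_on' with
    | add f g hf hg =>
      have := add_mem hf hg
      rw [map_add, map_add]
      convert this using 1; ring
    | monomial e c =>
      have h1 : curveMap k (p+1) m (monomial e c) = c • monomial (dg e) 1 := by
        rw [monomial_eq_mon, map_mul, curveMap_mon, ← algebraMap_eq, AlgHom.commutes,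
          ← Algebra.smul_def]
      rw [h1, map_smul, hΘ, monomial_eq_mon, monomial_eq_mon, smul_eq_C_mul, ← mul_sub, C_1,
        one_mul]
      apply Ideal.mul_mem_left
      have d0 : ∀ e, dg e 0 = (2*(p+m+1)+1) * e 0 + (2*(p+1)+1+m)* e 1 + (2*(p+1)+1) * e 2 := by
        intro e; simp [dg]
      have d1 : ∀ e, dg e 1 = m * (e 1 + 2 * e 2) + (2*(p+m+1)+1) * e 3 := by
        intro e; simp [dg]
      have e0 := DFunLike.congr_fun (hσ e) 0
      have e1 := DFunLike.congr_fun (hσ e) 1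
      generalize σ (dg e) = e' at e0 e1 ⊢
      rw [d0, d0] at e0
      rw [d1, d1] at e1
      refine mon_congr p m hm _ _ _ _ _ _ _ _ ?_ e1.symm
      have : (2*(p+m+1)+1) * (e 0 + e 1 + e 2 + e 3) = (2*(p+m+1)+1) *
        (e' 0 + e' 1 + e' 2 + e' 3) := by
        linarith
      exact Nat.eq_of_mul_eq_mul_left (by omega) this
  intro h hh
  have h0 : curveMap k (p+1) m h = 0 := hh
  have := main h
  rwa [h0, map_zero, sub_zero] at this

lemma P3_le (p m : ℕ) : P3 k p m ≤ curveIdeal k (p+1) m := by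
  rw [P3, Ideal.span_le]
  rintro x (rfl | rfl | rfl) <;>
  · change curveMap k (p+1) m _ = 0
    simp only [gA, gB, gC, curveMap, map_mul, map_pow, map_sub, aeval_X, Matrix.cons_val]
    ring
end Aux
section Aux2
variable {k : Type*} [Field k]

lemma sub_mem_of_X (e : R4 k →ₐ[k] R4 k) (I : Ideal (R4 k)) (h : ∀ i, X i - e (X i) ∈ I)
    (x : R4 k) : x - e x ∈ I := by
  induction x using MvPolynomial.induction_on with
  | C a => rw [← algebraMap_eq, AlgHom.commutes, sub_self]; exact zero_mem _
  | add f g hf hg =>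
    rw [map_add]; convert add_mem hf hg using 1; ring
  | mul_X f i hf =>
    rw [map_mul]
    have : f * X i - e f * e (X i) = X i * (f - e f) + e f * (X i - e (X i)) := by ring
    rw [this]
    exact add_mem (Ideal.mul_mem_left _ _ hf) (Ideal.mul_mem_left _ _ (h i))

/-- candidate for the symbolic powers -/
noncomputable def LL (k : Type*) [Field k] (p m : ℕ) : ℕ → Ideal (R4 k)
  | 0 => ⊤
  | 1 => P3 k p m
  | (n+2) => Ideal.span {gF k p m} * LL k p m n ⊔ Ideal.span {gA k ^ (n+1)} * P3 k p m

lemma gF_mul_mem {p m n : ℕ} {h : R4 k} (hh : h ∈ LL k p m n) :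
    gF k p m * h ∈ LL k p m (n+2) := by
  rw [LL]
  exact Ideal.mem_sup_left (Ideal.mul_mem_mul (Ideal.mem_span_singleton_self _) hh)

lemma gA_pow_mul_mem' {p m n : ℕ} {h : R4 k} (hh : h ∈ P3 k p m) :
    gA k ^ n * h ∈ LL k p m (n+1) := by
  cases n with
  | zero => simpa [LL] using hh
  | succ n =>
    rw [LL]
    exact Ideal.mem_sup_right (Ideal.mul_mem_mul (Ideal.mem_span_singleton_self _) hh)

lemma mem_LL_succ_succ {p m n : ℕ} {h : R4 k} (hh : h ∈ LL k p m (n+2)) :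
    ∃ h' ∈ LL k p m n, ∃ x ∈ P3 k p m, h = gF k p m * h' + gA k ^ (n+1) * x := by
  rw [LL] at hh
  obtain ⟨a, ha, b, hb, rfl⟩ := Submodule.mem_sup.1 hh
  obtain ⟨h', hh', rfl⟩ := Ideal.mem_span_singleton_mul.1 ha
  obtain ⟨x, hx, rfl⟩ := Ideal.mem_span_singleton_mul.1 hb
  exact ⟨h', hh', x, hx, rfl⟩

lemma gA_mul_mem (p m : ℕ) : ∀ n (h : R4 k), h ∈ LL k p m n → gA k * h ∈ LL k p m (n+1)
  | 0, h, _ => by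
    simpa [LL] using Ideal.mul_mem_right h _ (gA_mem p m)
  | 1, h, hh => by
    have := gA_pow_mul_mem' (n := 1) (show h ∈ P3 k p m by simpa [LL] using hh)
    simpa using this
  | n+2, h, hh => by
    obtain ⟨h', hh', x, hx, rfl⟩ := mem_LL_succ_succ hh
    have h1 := gF_mul_mem (gA_mul_mem p m n h' hh')
    have h2 := gA_pow_mul_mem' (n := n+2) hx
    have : gA k * (gF k p m * h' + gA k ^ (n+1) * x) =
      gF k p m * (gA k * h') + gA k ^ (n+2) * x := by ring
    rw [this]
    exact add_mem h1 h2

lemma gA_pow_mul_mem (p m s n : ℕ) (h : R4 k) (hh : h ∈ LL k p m n) :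
    gA k ^ s * h ∈ LL k p m (n+s) := by
  induction s with
  | zero => simpa using hh
  | succ s ih =>
    have := gA_mul_mem p m _ _ ih
    rw [pow_succ', mul_assoc]
    exact this

lemma syz (p m : ℕ) (β γ : R4 k) (h : β * X 1 + γ * X 2 ∈ P3 k p m) :
    ∃ s, ∃ l ∈ LL k p m 2, β * gB k p m + γ * gC k p m = s * gA k + l := by
  obtain ⟨c1, c2, c3, hc⟩ := mem_P3.1 h
  have hc2 : c2 ∈ Ideal.span {(X 1 : R4 k), X 2} := by
    let e : R4 k →ₐ[k] R4 k := aeval ![X 0, 0, 0, X 3]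
    have h1 : c2 - e c2 ∈ Ideal.span {(X 1 : R4 k), X 2} := by
      apply sub_mem_of_X
      intro i
      fin_cases i <;> simp [e]
      · exact Ideal.subset_span (by simp)
      · exact Ideal.subset_span (by simp)
    have h2 : e c2 = 0 := by
      have := congrArg e hc
      simp [e, gA, gB, gC] at this
      simpa [e] using this
    rwa [h2, sub_zero] at h1
  obtain ⟨e2, e3, he⟩ := Ideal.mem_span_pair.1 hc2
  set c : R4 k := X 2 ^ (p+m+1) with hcc
  set d : R4 k := X 0 ^ (p+1) * X 3 ^ m with hdd
  have hB : gB k p m = X 0 * d - X 1 * c := by rw [gB, hcc, hdd]; ring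
  have hC : gC k p m = X 1 * d - X 2 * c := by rw [gC, hcc, hdd]; ring
  set A := β + c1 * X 1 + c2 * c - c3 * d - e2 * X 0 * d with hA
  set B := γ - c1 * X 0 + c3 * c - e3 * X 0 * d with hBB
  have hAB : X 1 * A + X 2 * B = 0 := by
    rw [hA, hBB]
    rw [hB, hC, gA] at hc
    linear_combination hc - X 0 * d * he
  have hdvd : (X 2 : R4 k) ∣ A := by
    have h1 : (X 2 : R4 k) ∣ X 1 * A := ⟨-B, by linear_combination hAB⟩
    refine ((X_prime (R := k) (σ := Fin 4) (i := 2)).dvd_or_dvd h1).resolve_left ?_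
    rw [X_dvd_X]; simp
  obtain ⟨τ, hτ⟩ := hdvd
  have hBτ : B = - X 1 * τ := by
    have : (X 2 : R4 k) ≠ 0 := X_ne_zero _
    apply mul_left_cancel₀ this
    rw [hτ] at hAB
    linear_combination hAB
  have m1 : gF k p m ∈ LL k p m 2 := by
    simpa using gF_mul_mem (p := p) (m := m) (n := 0) (h := (1 : R4 k)) (by simp [LL])
  have m2 : gA k * gC k p m ∈ LL k p m 2 := by
    simpa using gA_pow_mul_mem' (n := 1) (gC_mem (k := k) p m)
  refine ⟨-c1 * c + τ * d + c3 * X 0 ^ p * X 3 ^ m * X 1 * X 2 ^ (p+m) - e3 * d * c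
      - e3 * X 2 ^ (p+m) * X 0 ^ p * X 3 ^ m * gA k,
    (c3 + e2 * X 0 + e3 * X 1) * gF k p m + (e2 * X 2 ^ (p+m)) * (gA k * gC k p m),
    add_mem (Ideal.mul_mem_left _ _ m1) (Ideal.mul_mem_left _ _ m2), ?_⟩
  have hβ : β = -c1 * X 1 - (e2 * X 1 + e3 * X 2) * c + c3 * d + e2 * X 0 * d + X 2 * τ := by
    rw [he]; linear_combination hτ
  have hγ : γ = c1 * X 0 - c3 * c + e3 * X 0 * d - X 1 * τ := by linear_combination hBτ
  have r1 := rel1 (k := k) p m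
  have r2 := rel2 (k := k) p m
  have r3 := rel3 (k := k) p m
  have r4 := rel4 (k := k) p m
  rw [← hcc] at r1
  rw [← hdd] at r2
  have hF : gF k p m = - c * gC k p m + d * gB k p m
      - X 0 ^ p * X 3 ^ m * X 1 * X 2 ^ (p+m) * gA k := by
    rw [gF, hcc, hdd]; ring
  rw [hβ, hγ]
  linear_combination c1 * r1 - τ * r2 - c3 * hF - e2 * gB k p m * hB - e2 * r3
    - e3 * r4 - e3 * gB k p m * hC + e3 * d * r1
end Aux2
set_option linter.unusedSectionVars false
set_option linter.unusedSimpArgs false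
section Leading
variable {S : Type*} [CommRing S] [IsDomain S]

/-- `h` has order at least `n` with coefficient `c` in degree `n` -/
def Ld (n : ℕ) (h : Polynomial S) (c : S) : Prop := Polynomial.X ^ n ∣ h ∧ h.coeff n = c

lemma Ld.mul {n n' : ℕ} {h h' : Polynomial S} {c c' : S} (H : Ld n h c) (H' : Ld n' h' c') :
    Ld (n+n') (h*h') (c*c') := by
  obtain ⟨⟨a, rfl⟩, rfl⟩ := H
  obtain ⟨⟨b, rfl⟩, rfl⟩ := H'
  have e : Polynomial.X ^ n * a * (Polynomial.X ^ n' * b) = Polynomial.X ^ (n+n') * (a * b) := by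
    ring
  refine ⟨⟨a * b, e⟩, ?_⟩
  rw [e]
  have h0 : ∀ (n : ℕ) (z : Polynomial S), (Polynomial.X ^ n * z).coeff n = z.coeff 0 := by
    intro n z
    simpa using Polynomial.coeff_X_pow_mul z n 0
  rw [h0, h0, h0, Polynomial.mul_coeff_zero]

lemma Ld.add {n : ℕ} {h h' : Polynomial S} {c c' : S} (H : Ld n h c) (H' : Ld n h' c') :
    Ld n (h+h') (c+c') :=
  ⟨dvd_add H.1 H'.1, by rw [Polynomial.coeff_add, H.2, H'.2]⟩

lemma Ld.sub {n : ℕ} {h h' : Polynomial S} {c c' : S} (H : Ld n h c) (H' : Ld n h' c') :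
    Ld n (h-h') (c-c') :=
  ⟨dvd_sub H.1 H'.1, by rw [Polynomial.coeff_sub, H.2, H'.2]⟩

lemma Ld.pow {n : ℕ} {h : Polynomial S} {c : S} (H : Ld n h c) (s : ℕ) :
    Ld (s*n) (h^s) (c^s) := by
  induction s with
  | zero => simp [Ld]
  | succ s ih =>
    rw [pow_succ, pow_succ, Nat.succ_mul]
    exact ih.mul H

lemma Ld.zero_of_dvd {n : ℕ} {h : Polynomial S} {c : S} (H : Ld n h c)
    (hd : Polynomial.X ^ (n+1) ∣ h) : c = 0 := by
  rw [← H.2]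
  exact Polynomial.X_pow_dvd_iff.1 hd n (by omega)

lemma Ld.dvd_of_zero {n : ℕ} {h : Polynomial S} (H : Ld n h 0) : Polynomial.X ^ (n+1) ∣ h := by
  rw [Polynomial.X_pow_dvd_iff]
  intro d hd
  rcases Nat.lt_succ_iff_lt_or_eq.1 hd with h1 | rfl
  · exact Polynomial.X_pow_dvd_iff.1 H.1 d h1
  · exact H.2

lemma Ld.of_dvd {n : ℕ} {h : Polynomial S} (H : Polynomial.X ^ n ∣ h) : Ld n h (h.coeff n) := ⟨H, rfl⟩

/-- cancel an element of nonzero leading coefficient -/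
lemma Ld.dvd_cancel {n s : ℕ} {h g : Polynomial S} {c : S} (H : Ld n h c) (hc : c ≠ 0)
    (hd : Polynomial.X ^ (n+s) ∣ h * g) : Polynomial.X ^ s ∣ g := by
  obtain ⟨⟨a, rfl⟩, hcc⟩ := H
  have h0 : a.coeff 0 = c := by
    rw [← hcc]; simpa using (Polynomial.coeff_X_pow_mul a n 0).symm
  rw [mul_assoc, pow_add] at hd
  have h1 := (mul_dvd_mul_iff_left (pow_ne_zero n Polynomial.X_ne_zero)).1 hd
  refine Polynomial.prime_X.pow_dvd_of_dvd_mul_left s ?_ h1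
  rw [Polynomial.X_dvd_iff, h0]
  exact hc

lemma one_add_pow (u : S) (s : ℕ) : ∃ r : Polynomial S, (1 + Polynomial.X * Polynomial.C u) ^ s =
    1 + Polynomial.X * Polynomial.C (s * u) + Polynomial.X ^ 2 * r := by
  induction s with
  | zero => exact ⟨0, by simp⟩
  | succ s ih =>
    obtain ⟨r, hr⟩ := ih
    refine ⟨r * (1 + Polynomial.X * Polynomial.C u) + Polynomial.C (s * u) * Polynomial.C u, ?_⟩
    rw [pow_succ, hr]
    have : Polynomial.C (((s+1 : ℕ) : S) * u) = Polynomial.C (s * u) + Polynomial.C u := by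
      rw [← Polynomial.C_add]; push_cast; ring_nf
    rw [this]; ring

lemma Ld_one_of_eq {h r : Polynomial S} {c : S}
    (e : h = Polynomial.X * Polynomial.C c + Polynomial.X ^ 2 * r) : Ld 1 h c := by
  subst e
  refine ⟨⟨Polynomial.C c + Polynomial.X * r, by ring⟩, ?_⟩
  have h2 : (Polynomial.X ^ 2 * r).coeff 1 = 0 :=
    Polynomial.X_pow_dvd_iff.1 (Dvd.intro r rfl) 1 (by norm_num)
  rw [Polynomial.coeff_add, h2, Polynomial.coeff_X_mul]
  simp

lemma Ld.cancel {s : ℕ} {h g : Polynomial S} {c e : S} (H : Ld 0 h c) (hc : c ≠ 0)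
    (hd : Ld s (h * g) (c * e)) : Ld s g e := by
  have h1 : Polynomial.X ^ s ∣ g := by
    refine H.dvd_cancel (s := s) hc ?_
    rw [zero_add]; exact hd.1
  have h2 := (H.mul (Ld.of_dvd h1)).2
  rw [zero_add, hd.2] at h2
  exact ⟨h1, (mul_left_cancel₀ hc h2).symm⟩

lemma Ld.congr {n n' : ℕ} {h h' : Polynomial S} {c c' : S} (H : Ld n h c) (hn : n = n')
    (hh : h = h') (hc : c = c') : Ld n' h' c' := by
  subst hn hh hc; exact H

end Leading

section Core
variable {k : Type*} [Field k] {p m : ℕ} {B : Type*} [CommRing B] [IsDomain B]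

/-- constants -/
noncomputable def cst (B : Type*) [CommRing B] : B →+* Polynomial (Polynomial B) :=
  Polynomial.C.comp Polynomial.C

lemma cst_apply (a : B) : cst B a = Polynomial.C (Polynomial.C a) := rfl

/-- the deformation of the parametrization -/
structure Dat (p m : ℕ) (F : R4 k →+* B) (Ψ : R4 k →+* Polynomial (Polynomial B))
    (v u t : Polynomial B) : Prop where
  ker : ∀ h, F h = 0 ↔ h ∈ P3 k p m
  X_ne : ∀ i, F (X i) ≠ 0
  x0 : Ψ (X 0) = cst B (F (X 0))
  x1 : Ψ (X 1) = cst B (F (X 1)) * (1 + Polynomial.X * Polynomial.C v)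
  x2 : Ψ (X 2) = cst B (F (X 2)) * (1 + Polynomial.X * Polynomial.C u)
  x3 : Ψ (X 3) = cst B (F (X 3)) * (1 + Polynomial.X * Polynomial.C t)
  co : ∀ h, (Ψ h).coeff 0 = Polynomial.C (F h)
  hu : u = 1 + 2 * v
  hz : -v - ((p+m+1 : ℕ) : Polynomial B) * u + (m : Polynomial B) * t = Polynomial.X

variable {F : R4 k →+* B} {Ψ : R4 k →+* Polynomial (Polynomial B)}
  {v u t : Polynomial B}


lemma Dat.zero (D : Dat p m F Ψ v u t) (h : R4 k) : Ld 0 (Ψ h) (Polynomial.C (F h)) := ⟨by simp, D.co h⟩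

lemma Dat.ker_le (D : Dat p m F Ψ v u t) {h : R4 k} (hh : F h = 0) : h ∈ P3 k p m := (D.ker h).1 hh

lemma Dat.cB (D : Dat p m F Ψ v u t) : F (X 0 ^ (p+2) * X 3 ^ m) = F (X 1 * X 2 ^ (p+m+1)) := by
  have : F (gB k p m) = 0 := (D.ker _).2 (gB_mem p m)
  rwa [gB, map_sub, sub_eq_zero] at this

lemma Dat.cC (D : Dat p m F Ψ v u t) : F (X 0 ^ (p+1) * X 1 * X 3 ^ m) = F (X 2 ^ (p+m+2)) := by
  have : F (gC k p m) = 0 := (D.ker _).2 (gC_mem p m)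
  rwa [gC, map_sub, sub_eq_zero] at this

lemma Dat.cA (D : Dat p m F Ψ v u t) : F (X 0 * X 2) = F (X 1 ^ 2) := by
  have : F (gA k) = 0 := (D.ker _).2 (gA_mem p m)
  rwa [gA, map_sub, sub_eq_zero] at this


lemma Ld_gA (D : Dat p m F Ψ v u t) : Ld 1 (Ψ (gA k)) (Polynomial.C (F (X 0 * X 2))) := by
  apply Ld_one_of_eq (r := - cst B (F (X 0 * X 2)) * Polynomial.C (v ^ 2))
  have e : Ψ (gA k) =
      cst B (F (X 0 * X 2)) * (1 + Polynomial.X * Polynomial.C u) -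
      cst B (F (X 1 ^ 2)) * (1 + Polynomial.X * Polynomial.C v) ^ 2 := by
    simp only [gA, map_sub, map_mul, map_pow, D.x0, D.x1, D.x2, D.x3, mul_pow]
    ring
  rw [e, ← D.cA, D.hu, ← cst_apply]
  simp only [map_add, map_mul, map_pow, map_one, map_ofNat]
  ring

lemma Ld_gB (D : Dat p m F Ψ v u t) : Ld 1 (Ψ (gB k p m))
    (Polynomial.C (F (X 1 * X 2 ^ (p+m+1))) * Polynomial.X) := by
  obtain ⟨r1, h1⟩ := one_add_pow t m
  obtain ⟨r2, h2⟩ := one_add_pow u (p+m+1)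
  apply Ld_one_of_eq (r := cst B (F (X 1 * X 2 ^ (p+m+1))) *
    (r1 - r2 - Polynomial.C v * Polynomial.C (((p+m+1 : ℕ) : Polynomial B) * u) -
      Polynomial.X * Polynomial.C v * r2))
  have e : Ψ (gB k p m) =
      cst B (F (X 0 ^ (p+2) * X 3 ^ m)) * (1 + Polynomial.X * Polynomial.C t) ^ m -
      cst B (F (X 1 * X 2 ^ (p+m+1))) * (1 + Polynomial.X * Polynomial.C v) *
        (1 + Polynomial.X * Polynomial.C u) ^ (p+m+1) := by
    simp only [gB, map_sub, map_mul, map_pow, D.x0, D.x1, D.x2, D.x3, mul_pow]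
    ring
  rw [e, D.cB, h1, h2, ← D.hz, Polynomial.C_mul (a := Polynomial.C _), ← cst_apply]
  simp only [map_add, map_sub, map_neg]
  ring

lemma Ld_gC (D : Dat p m F Ψ v u t) : Ld 1 (Ψ (gC k p m))
    (Polynomial.C (F (X 2 ^ (p+m+2))) * (Polynomial.X - 1)) := by
  obtain ⟨r1, h1⟩ := one_add_pow t m
  obtain ⟨r2, h2⟩ := one_add_pow u (p+m+2)
  apply Ld_one_of_eq (r := cst B (F (X 2 ^ (p+m+2))) *
    (r1 - r2 + Polynomial.C v * Polynomial.C ((m : Polynomial B) * t) + Polynomial.X * Polynomial.C v * r1))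
  have e : Ψ (gC k p m) =
      cst B (F (X 0 ^ (p+1) * X 1 * X 3 ^ m)) *
        (1 + Polynomial.X * Polynomial.C v) * (1 + Polynomial.X * Polynomial.C t) ^ m -
      cst B (F (X 2 ^ (p+m+2))) *
        (1 + Polynomial.X * Polynomial.C u) ^ (p+m+2) := by
    simp only [gC, map_sub, map_mul, map_pow, D.x0, D.x1, D.x2, D.x3, mul_pow]
    ring
  have hz' : (Polynomial.X : Polynomial B) - 1 = v + (m : Polynomial B) * t - ((p+m+2 : ℕ) : Polynomial B) * u := by
    rw [← D.hz]; push_cast; linear_combination D.hu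
  rw [e, D.cC, h1, h2, hz', Polynomial.C_mul (a := Polynomial.C _), ← cst_apply]
  simp only [map_add, map_sub]
  ring

lemma Ld_gF (D : Dat p m F Ψ v u t) : Ld 2 (Ψ (gF k p m))
    (Polynomial.C (F (X 2 ^ (2*(p+m+1)+1))) *
      (Polynomial.X ^ 2 - Polynomial.X + 1)) := by
  have hA := Ld_gA D
  have hB := Ld_gB D
  have hC := Ld_gC D
  have h2 := D.zero (X 2 ^ (p+m))
  have h0 := D.zero (X 0)
  have hh := (hB.pow 2).sub (((h2.mul hA).mul hC).congr (n' := 2 * 1) (by norm_num) rfl rfl)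
  have e : Ψ (gB k p m) ^ 2 - Ψ (X 2 ^ (p+m)) * Ψ (gA k) * Ψ (gC k p m) =
      Ψ (X 0) * Ψ (gF k p m) := by
    rw [← map_mul Ψ (X 0), rel3]; simp only [map_sub, map_mul, map_pow]
  have hne : (Polynomial.C (F (X 0)) : Polynomial B) ≠ 0 := by
    rw [Ne, Polynomial.C_eq_zero]; exact D.X_ne 0
  refine h0.cancel hne (hh.congr (by norm_num) e ?_)
  have hA' := D.cA
  have e2 : F (X 1 * X 2 ^ (p+m+1)) ^ 2 = F (X 0) * F (X 2 ^ (2*(p+m+1)+1)) := by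
    simp only [map_mul, map_pow] at hA' ⊢
    rw [mul_pow, ← hA']; ring
  have e3 : F (X 2 ^ (p+m)) * F (X 0 * X 2) * F (X 2 ^ (p+m+2)) =
     F (X 0) * F (X 2 ^ (2*(p+m+1)+1)) := by
    simp only [map_mul, map_pow]; ring
  have e2' := congrArg (Polynomial.C : B → Polynomial B) e2
  have e3' := congrArg (Polynomial.C : B → Polynomial B) e3
  rw [Polynomial.C_mul, Polynomial.C_pow] at e2'
  rw [Polynomial.C_mul, Polynomial.C_mul, Polynomial.C_mul] at e3'
  generalize (Polynomial.C (F (X 1 * X 2 ^ (p+m+1))) : Polynomial B) = w1 at *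
  generalize (Polynomial.C (F (X 2 ^ (p+m))) : Polynomial B) = w2 at *
  generalize (Polynomial.C (F (X 0 * X 2)) : Polynomial B) = w3 at *
  generalize (Polynomial.C (F (X 2 ^ (p+m+2))) : Polynomial B) = w4 at *
  generalize (Polynomial.C (F (X 2 ^ (2*(p+m+1)+1))) : Polynomial B) = w5 at *
  generalize (Polynomial.C (F (X 0)) : Polynomial B) = w6 at *
  linear_combination Polynomial.X ^ 2 * e2' - (Polynomial.X - 1) * e3'

lemma dvd_P3 (D : Dat p m F Ψ v u t) {h : R4 k} (hh : h ∈ P3 k p m) : Polynomial.X ∣ Ψ h := by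
  obtain ⟨a, b, c, rfl⟩ := mem_P3.1 hh
  have hA := (Ld_gA D).1
  have hB := (Ld_gB D).1
  have hC := (Ld_gC D).1
  rw [pow_one] at hA hB hC
  simp only [map_add, map_mul]
  exact dvd_add (dvd_add (hA.mul_left _) (hB.mul_left _)) (hC.mul_left _)

lemma dvd_LL (D : Dat p m F Ψ v u t) : ∀ n (h : R4 k), h ∈ LL k p m n → Polynomial.X ^ n ∣ Ψ h
  | 0, h, _ => by simp
  | 1, h, hh => by
    rw [pow_one]; exact dvd_P3 D (by simpa [LL] using hh)
  | n+2, h, hh => by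
    obtain ⟨h', hh', x, hx, rfl⟩ := mem_LL_succ_succ hh
    have h1 := dvd_LL D n h' hh'
    have h2 := dvd_P3 D hx
    have h3 := (Ld_gF D).1
    have h4 := ((Ld_gA D).pow (n+1)).1
    simp only [map_add, map_mul, map_pow]
    apply dvd_add
    · rw [add_comm n 2, pow_add]; exact mul_dvd_mul h3 h1
    · rw [mul_one] at h4
      rw [pow_succ]; exact mul_dvd_mul h4 h2

lemma Ld_x (D : Dat p m F Ψ v u t) (α β γ : R4 k) :
    Ld 1 (Ψ (α * gA k + β * gB k p m + γ * gC k p m))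
      (Polynomial.C (F (X 2 ^ (p+m+1) * (β * X 1 + γ * X 2))) * Polynomial.X +
       Polynomial.C (F (α * (X 0 * X 2) - γ * X 2 ^ (p+m+2)))) := by
  have hA := (D.zero α).mul (Ld_gA D)
  have hB := (D.zero β).mul (Ld_gB D)
  have hC := (D.zero γ).mul (Ld_gC D)
  have := (hA.add hB).add hC
  simp only [← map_mul, ← map_add] at this
  convert this using 1
  simp only [map_add, map_sub, map_mul, map_pow]
  ring

lemma lin_zero {a b : B} (h : Polynomial.C a * Polynomial.X + Polynomial.C b = 0) : a = 0 := by
  have := congrArg (fun z => Polynomial.coeff z 1) h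
  simpa [Polynomial.coeff_C] using this

lemma mem_two (D : Dat p m F Ψ v u t) (x : R4 k) (hx : x ∈ P3 k p m)
    (hd : Polynomial.X ^ 2 ∣ Ψ x) : x ∈ LL k p m 2 := by
  obtain ⟨α, β, γ, rfl⟩ := mem_P3.1 hx
  have h0 := (Ld_x D α β γ).zero_of_dvd hd
  have h1 := lin_zero h0
  have h2 : F (β * X 1 + γ * X 2) = 0 := by
    rw [map_mul, mul_eq_zero, map_pow] at h1
    exact h1.resolve_left (pow_ne_zero _ (D.X_ne 2))
  obtain ⟨s, l, hl, e⟩ := syz p m β γ (D.ker_le h2)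
  have e' : α * gA k + β * gB k p m + γ * gC k p m = (α + s) * gA k + l := by
    linear_combination e
  rw [e'] at hd ⊢
  refine add_mem ?_ hl
  have h3 := dvd_LL D 2 l hl
  rw [map_add] at hd
  have h4 := (dvd_add_left h3).1 hd
  rw [map_mul] at h4
  have h5 := ((D.zero (α + s)).mul (Ld_gA D)).zero_of_dvd h4
  rw [← Polynomial.C_mul, Polynomial.C_eq_zero, map_mul, mul_eq_zero] at h5
  have h6 := h5.resolve_right (mul_ne_zero (D.X_ne 0) (D.X_ne 2))
  have h7 : α + s ∈ P3 k p m := D.ker_le h6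
  have := gA_pow_mul_mem' (n := 1) h7
  rwa [pow_one, mul_comm] at this

lemma step (D : Dat p m F Ψ v u t) : ∀ n (h : R4 k), h ∈ LL k p m n →
    Polynomial.X ^ (n+1) ∣ Ψ h → h ∈ LL k p m (n+1)
  | 0, h, _, hd => by
    have := (D.zero h).zero_of_dvd hd
    rw [Polynomial.C_eq_zero] at this
    simpa [LL] using D.ker_le this
  | 1, h, hh, hd => mem_two D h (by simpa [LL] using hh) hd
  | n+2, h, hh, hd => by
    obtain ⟨h', hh', x, hx, rfl⟩ := mem_LL_succ_succ hh
    have hF := Ld_gF D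
    have hA := (Ld_gA D).pow (n+1)
    have hQ : (Polynomial.X ^ 2 - Polynomial.X + 1 : Polynomial B) ≠ 0 := by
      intro h
      have := congrArg (fun z => Polynomial.coeff z 0) h
      simp at this
    have hQm : (Polynomial.X ^ 2 - Polynomial.X + 1 : Polynomial B).natDegree = 2 := by
      compute_degree!
    have hx2 : Polynomial.X ^ 2 ∣ Ψ x := by
      obtain ⟨α, β, γ, rfl⟩ := mem_P3.1 hx
      have hX := Ld_x D α β γ
      have h1 := Ld.of_dvd (dvd_LL D n h' hh')
      have h2 := hA.mul hX
      have h3 := hF.mul h1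
      rw [show (n+1) * 1 + 1 = 2 + n by ring] at h2
      have h4 := h3.add h2
      rw [← map_pow, ← map_mul, ← map_mul, ← map_add] at h4
      have h5 := h4.zero_of_dvd (by convert hd using 2; ring)
      set lin := (Polynomial.C (F (X 2 ^ (p+m+1) * (β * X 1 + γ * X 2)))
        * Polynomial.X +
       Polynomial.C (F (α * (X 0 * X 2) - γ * X 2 ^ (p+m+2))) : Polynomial B) with hlin
      have hdeg : lin.natDegree ≤ 1 := Polynomial.natDegree_linear_le
      suffices hl0 : lin = 0 by
        rw [hl0] at hX; exact hX.dvd_of_zero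
      have hdvd : (Polynomial.X ^ 2 - Polynomial.X + 1 : Polynomial B) ∣
          Polynomial.C (F (X 0 * X 2)) ^ (n+1) * lin :=
        ⟨- Polynomial.C (F (X 2 ^ (2*(p+m+1)+1))) *
          (Ψ h').coeff n, by linear_combination h5⟩
      have hz0 : Polynomial.C (F (X 0 * X 2)) ^ (n+1) * lin = 0 := by
        apply Polynomial.eq_zero_of_dvd_of_natDegree_lt hdvd
        rw [hQm, ← Polynomial.C_pow]
        exact lt_of_le_of_lt (Polynomial.natDegree_C_mul_le _ _) (by omega)
      refine (mul_eq_zero.1 hz0).resolve_left (pow_ne_zero _ ?_)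
      rw [Ne, Polynomial.C_eq_zero, map_mul]
      exact mul_ne_zero (D.X_ne 0) (D.X_ne 2)
    have hxm := mem_two D x hx hx2
    have hAx := gA_pow_mul_mem p m (n+1) 2 x hxm
    rw [show 2 + (n+1) = n + 2 + 1 by ring] at hAx
    refine add_mem ?_ hAx
    have h6 := dvd_LL D _ _ hAx
    rw [map_add] at hd
    have h7 := (dvd_add_left h6).1 hd
    rw [map_mul, show n + 2 + 1 = 2 + (n+1) by ring] at h7
    have h8 := hF.dvd_cancel (mul_ne_zero (by
      rw [Ne, Polynomial.C_eq_zero, map_pow]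
      exact pow_ne_zero _ (D.X_ne 2)) hQ) h7
    exact gF_mul_mem (step D n h' hh' h8)

lemma mem_LL_of_dvd (D : Dat p m F Ψ v u t) (n : ℕ) (h : R4 k)
    (hd : Polynomial.X ^ n ∣ Ψ h) : h ∈ LL k p m n := by
  induction n with
  | zero => simp [LL]
  | succ n ih =>
    exact step D n h (ih ((pow_dvd_pow _ (Nat.le_succ n)).trans hd)) hd


lemma dvd_psi_pow (D : Dat p m F Ψ v u t) (n : ℕ) (h : R4 k) (hh : h ∈ P3 k p m ^ n) : Polynomial.X ^ n ∣ Ψ h := by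
  have h1 : P3 k p m ≤ (Ideal.span {(Polynomial.X : Polynomial (Polynomial B))}).comap Ψ := by
    intro x hx
    rw [Ideal.mem_comap, Ideal.mem_span_singleton]
    exact dvd_P3 D hx
  have h2 := ((Ideal.pow_right_mono h1 n).trans (Ideal.le_comap_pow _ _)) hh
  rwa [Ideal.mem_comap, Ideal.span_singleton_pow, Ideal.mem_span_singleton] at h2

lemma sat (D : Dat p m F Ψ v u t) {n : ℕ} {h s : R4 k} (hs : F s ≠ 0) (hh : s * h ∈ P3 k p m ^ n) : h ∈ LL k p m n := by
  apply mem_LL_of_dvd D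
  have h2 := dvd_psi_pow D n _ hh
  rw [map_mul] at h2
  refine (D.zero s).dvd_cancel (s := n) ?_ (by rwa [zero_add])
  rwa [Ne, Polynomial.C_eq_zero]

/-- the deformed map -/
noncomputable def psi (F : R4 k →+* B) (v u t : Polynomial B) :
    R4 k →+* Polynomial (Polynomial B) :=
  eval₂Hom ((cst B).comp (F.comp C)) ![cst B (F (X 0)),
    cst B (F (X 1)) * (1 + Polynomial.X * Polynomial.C v),
    cst B (F (X 2)) * (1 + Polynomial.X * Polynomial.C u),
    cst B (F (X 3)) * (1 + Polynomial.X * Polynomial.C t)]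

lemma psi_co (F : R4 k →+* B) (v u t : Polynomial B) (h : R4 k) :
    (psi F v u t h).coeff 0 = Polynomial.C (F h) := by
  have hw : ∀ (a : B) (w : Polynomial B),
      (cst B a * (1 + Polynomial.X * Polynomial.C w)).coeff 0 = Polynomial.C a := by
    intro a w
    rw [cst_apply, Polynomial.mul_coeff_zero]
    simp
  induction h using MvPolynomial.induction_on with
  | C a => rw [psi, eval₂Hom_C]; simp [cst_apply]
  | add f g hf hg => rw [map_add, map_add, Polynomial.coeff_add, hf, hg, Polynomial.C_add]
  | mul_X f i hf =>
    rw [map_mul, map_mul, Polynomial.mul_coeff_zero, hf, Polynomial.C_mul]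
    congr 1
    rw [psi, eval₂Hom_X']
    match i with
    | 0 => simp [cst_apply]
    | 1 => exact hw _ _
    | 2 => exact hw _ _
    | 3 => exact hw _ _

lemma psi_dat (F : R4 k →+* B) (v u t : Polynomial B) (ker : ∀ h, F h = 0 ↔ h ∈ P3 k p m)
    (X_ne : ∀ i, F (X i) ≠ 0) (hu : u = 1 + 2 * v)
    (hz : -v - ((p+m+1 : ℕ) : Polynomial B) * u + (m : Polynomial B) * t = Polynomial.X) :
    Dat p m F (psi F v u t) v u t where
  ker := ker
  X_ne := X_ne
  x0 := by rw [psi, eval₂Hom_X']; rfl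
  x1 := by rw [psi, eval₂Hom_X']; rfl
  x2 := by rw [psi, eval₂Hom_X']; rfl
  x3 := by rw [psi, eval₂Hom_X']; rfl
  co := psi_co F v u t
  hu := hu
  hz := hz

lemma sat' (hco : Nat.Coprime (2*(p+m+1)+1) m) (F : R4 k →+* B)
    (ker : ∀ h, F h = 0 ↔ h ∈ P3 k p m) (X_ne : ∀ i, F (X i) ≠ 0)
    {n : ℕ} {h s : R4 k} (hs : F s ≠ 0) (hh : s * h ∈ P3 k p m ^ n) : h ∈ LL k p m n := by
  obtain ⟨a, b, hab⟩ := Int.isCoprime_iff_gcd_eq_one.2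
    (show Int.gcd (2*(p+m+1)+1 : ℕ) m = 1 from hco)
  have hab' := congrArg (Int.cast : ℤ → Polynomial B) hab
  push_cast at hab'
  refine sat (psi_dat F
    (-(a : Polynomial B) * (Polynomial.X + ((p : Polynomial B) + (m : Polynomial B) + 1))) _
    ((b : Polynomial B) * (Polynomial.X + ((p : Polynomial B) + (m : Polynomial B) + 1)))
    ker X_ne rfl ?_) hs hh
  push_cast
  linear_combination (Polynomial.X + ((p : Polynomial B) + (m : Polynomial B) + 1)) * hab'
end Core

section Aux3
variable {k : Type*} [Field k]

lemma curveMap_X_ne (q m : ℕ) (i : Fin 4) : curveMap k q m (X i) ≠ 0 := by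
  fin_cases i <;> simp [curveMap, X_ne_zero]

lemma symb_le (p m : ℕ) (hco : Nat.Coprime (2*(p+m+1)+1) m) (n : ℕ) :
    symbPow k (p+1) m n ≤ LL k p m n := by
  intro h hh
  rw [symbPow, Ideal.mem_comap,
    IsLocalization.mem_map_algebraMap_iff (curveIdeal k (p+1) m).primeCompl] at hh
  obtain ⟨⟨⟨a, ha⟩, ⟨s, hs⟩⟩, e⟩ := hh
  simp only at e
  rw [← map_mul] at e
  have e' := IsLocalization.injective (Localization.AtPrime (curveIdeal k (p+1) m))
    (curveIdeal k (p+1) m).primeCompl_le_nonZeroDivisors e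
  have hP : curveIdeal k (p+1) m = P3 k p m := le_antisymm (ker_le p m hco) (P3_le p m)
  rw [← e', hP, mul_comm] at ha
  refine sat' hco (curveMap k (p+1) m).toRingHom (fun x => ?_) (curveMap_X_ne (p+1) m) (s := s) ?_ ha
  · rw [← hP]; rfl
  · exact hs



lemma pw (m n : ℕ) (h : m ≤ n) (I : Ideal (R4 k)) : I ^ n ≤ I ^ m := Ideal.pow_le_pow_right h

lemma LL_le (p m : ℕ) (M : Ideal (R4 k)) (h1 : P3 k p m ≤ M ^ 2)
    (h2 : gF k p m ∈ M ^ 2 * P3 k p m) : ∀ n,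
    LL k p m (2*n) ≤ M ^ (2*n) * P3 k p m ^ n ∧
    LL k p m (2*n+1) ≤ M ^ (2*n) * P3 k p m ^ (n+1) := by
  have h2' : Ideal.span {gF k p m} ≤ M ^ 2 * P3 k p m := by
    rw [Ideal.span_le]; simpa using h2
  have h3 : ∀ s, Ideal.span {gA k ^ s} ≤ P3 k p m ^ s := by
    intro s
    rw [Ideal.span_le]; simpa using Ideal.pow_mem_pow (gA_mem p m) s
  have h4 : ∀ s, P3 k p m ^ s ≤ M ^ (2*s) := by
    intro s
    rw [pow_mul]; exact Ideal.pow_right_mono h1 s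
  intro n
  induction n with
  | zero => simp [LL]
  | succ n ih =>
    obtain ⟨i1, i2⟩ := ih
    constructor
    · rw [show 2 * (n+1) = 2*n+2 by ring, LL]
      apply sup_le
      · refine (Ideal.mul_mono h2' i1).trans (le_of_eq ?_)
        ring
      · refine (Ideal.mul_mono_left (h3 _)).trans ?_
        rw [← pow_succ, show 2*n+1+1 = (n+1)+(n+1) by ring, pow_add]
        exact (Ideal.mul_mono_left (h4 _)).trans (le_of_eq (by ring))
    · rw [show 2 * (n+1)+1 = (2*n+1)+2 by ring, LL]
      apply sup_le
      · refine (Ideal.mul_mono h2' i2).trans (le_of_eq ?_)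
        ring
      · refine (Ideal.mul_mono_left (h3 _)).trans ?_
        rw [← pow_succ, show 2*n+1+1+1 = (n+1)+(n+2) by ring, pow_add]
        exact (Ideal.mul_mono_left (h4 _)).trans (le_of_eq (by ring))

end Aux3
/-- For all `n ≥ 1`, `𝔭⁽³ⁿ⁾ ⊆ 𝔪²ⁿ·𝔭ⁿ` where `𝔪 = (x₁,x₂,x₃,x₄)`;
moreover the stronger containments `𝔭⁽²ⁿ⁾ ⊆ 𝔪ⁿ·𝔭ⁿ` and `𝔭⁽²ⁿ⁺¹⁾ ⊆ 𝔪ⁿ·𝔭ⁿ` hold. -/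
theorem statement16 (k : Type*) [Field k] (q m : ℕ) (hq : 1 ≤ q) (hm : 1 ≤ m)
    (hco : Nat.Coprime (2*q+1) m) :
    ∀ n : ℕ, 1 ≤ n →
      symbPow k q m (3*n) ≤
        (Ideal.span {(X 0 : MvPolynomial (Fin 4) k), X 1, X 2, X 3}) ^ (2*n)
          * (curveIdeal k q m) ^ n ∧
      symbPow k q m (2*n) ≤
        (Ideal.span {(X 0 : MvPolynomial (Fin 4) k), X 1, X 2, X 3}) ^ n
          * (curveIdeal k q m) ^ n ∧
      symbPow k q m (2*n+1) ≤
        (Ideal.span {(X 0 : MvPolynomial (Fin 4) k), X 1, X 2, X 3}) ^ n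
          * (curveIdeal k q m) ^ n := by
  obtain ⟨p, rfl⟩ : ∃ p, q = p + 1 := ⟨q - 1, by omega⟩
  have hco' : Nat.Coprime (2*(p+m+1)+1) m := by
    have : 2*(p+m+1)+1 = 2*(p+1)+1 + 2*m := by ring
    rw [this]
    simpa using hco
  have hP : curveIdeal k (p+1) m = P3 k p m := le_antisymm (ker_le p m hco') (P3_le p m)
  set M : Ideal (MvPolynomial (Fin 4) k) := Ideal.span {X 0, X 1, X 2, X 3} with hM
  have m0 : (X 0 : R4 k) ∈ M := Ideal.subset_span (by simp)
  have m1 : (X 1 : R4 k) ∈ M := Ideal.subset_span (by simp)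
  have m2 : (X 2 : R4 k) ∈ M := Ideal.subset_span (by simp)
  have m3 : (X 3 : R4 k) ∈ M := Ideal.subset_span (by simp)
  have mm : ∀ {a b : R4 k}, a ∈ M → b ∈ M → a * b ∈ M ^ 2 := by
    intro a b ha hb
    rw [pow_two]; exact Ideal.mul_mem_mul ha hb
  have h1 : P3 k p m ≤ M ^ 2 := by
    intro x hx
    obtain ⟨a, b, c, rfl⟩ := mem_P3.1 hx
    have t1 : gA k ∈ M ^ 2 := by
      rw [gA]
      exact sub_mem (mm m0 m2) (by have := mm m1 m1; rwa [← pow_two] at this)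
    have t2 : gB k p m ∈ M ^ 2 := by
      have : gB k p m = (X 0 ^ p * X 3 ^ m) * (X 0 * X 0) - X 2 ^ (p+m) * (X 1 * X 2) := by
        rw [gB]; ring
      rw [this]
      exact sub_mem (Ideal.mul_mem_left _ _ (mm m0 m0)) (Ideal.mul_mem_left _ _ (mm m1 m2))
    have t3 : gC k p m ∈ M ^ 2 := by
      have : gC k p m = (X 0 ^ p * X 3 ^ m) * (X 0 * X 1) - X 2 ^ (p+m) * (X 2 * X 2) := by
        rw [gC]; ring
      rw [this]
      exact sub_mem (Ideal.mul_mem_left _ _ (mm m0 m1)) (Ideal.mul_mem_left _ _ (mm m2 m2))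
    exact add_mem (add_mem (Ideal.mul_mem_left _ _ t1) (Ideal.mul_mem_left _ _ t2))
      (Ideal.mul_mem_left _ _ t3)
  have h2 : gF k p m ∈ M ^ 2 * P3 k p m := by
    obtain ⟨r, rfl⟩ : ∃ r, m = r + 1 := ⟨m - 1, by omega⟩
    have : gF k p (r+1) = (- X 2 ^ (p+r)) * ((X 2 * X 2) * gC k p (r+1))
      + (X 0 ^ p * X 3 ^ r) * ((X 0 * X 3) * gB k p (r+1))
      - (X 0 ^ p * X 3 ^ (r+1) * X 2 ^ (p+r)) * ((X 1 * X 2) * gA k) := by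
      rw [gF]; ring
    rw [this]
    exact sub_mem (add_mem
      (Ideal.mul_mem_left _ _ (Ideal.mul_mem_mul (mm m2 m2) (gC_mem _ _)))
      (Ideal.mul_mem_left _ _ (Ideal.mul_mem_mul (mm m0 m3) (gB_mem _ _))))
      (Ideal.mul_mem_left _ _ (Ideal.mul_mem_mul (mm m1 m2) (gA_mem _ _)))
  have hL := LL_le p m M h1 h2
  intro n hn
  rw [hP]
  refine ⟨?_, ?_, ?_⟩
  · refine (symb_le p m hco' (3*n)).trans ?_
    rcases Nat.even_or_odd' n with ⟨j, rfl | rfl⟩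
    · rw [show 3 * (2*j) = 2 * (3*j) by ring]
      exact (hL _).1.trans (Ideal.mul_mono (pw _ _ (by omega) _) (pw _ _ (by omega) _))
    · rw [show 3 * (2*j+1) = 2 * (3*j+1) + 1 by ring]
      exact (hL _).2.trans (Ideal.mul_mono (pw _ _ (by omega) _) (pw _ _ (by omega) _))
  · exact (symb_le p m hco' (2*n)).trans ((hL _).1.trans
      (Ideal.mul_mono (pw _ _ (by omega) _) (pw _ _ (by omega) _)))
  · exact (symb_le p m hco' (2*n+1)).trans ((hL _).2.trans
      (Ideal.mul_mono (pw _ _ (by omega) _) (pw _ _ (by omega) _)))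
end
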